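/- Let S be a set of N points in the plane in general position with N even, let T be a triangulation of S, and let M be a perfect matching of S all of whose edges belong to T. Then supp(M) ≥ 2^{N/2 − 3}, i.e., M is contained in at least 2^{N/2−3} triangulations of S. -/

import Mathlib

open scoped Classical

noncomputable section

/-- Points of the plane. -/
abbrev Pt : Type := ℝ × ℝ

/-- A finite point set is in general position if no three of its points are collinear. -/
def GenPos (S : Finset Pt) : Prop :=
  ∀ p ∈ S, ∀ q ∈ S, ∀ r ∈ S, p ≠ q → p ≠ r → q ≠ r →
    ¬ Collinear ℝ ({p, q, r} : Set Pt)

/-- The closed straight segment spanned by an unordered pair of points. -/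
def seg2 (e : Sym2 Pt) : Set Pt :=
  Sym2.lift ⟨fun p q => segment ℝ p q, fun p q => segment_symm ℝ p q⟩ e

/-- A crossing-free straight-edge graph (plane graph) on the point set `S`:
its edges are straight segments between points of `S`, any two of which
meet only at shared endpoints. -/
structure PlaneGraph (S : Finset Pt) where
  edges : Finset (Sym2 Pt)
  endpoint_mem : ∀ e ∈ edges, ∀ p, p ∈ e → p ∈ S
  not_isDiag : ∀ e ∈ edges, ¬ e.IsDiag
  noncrossing : ∀ e₁ ∈ edges, ∀ e₂ ∈ edges, e₁ ≠ e₂ →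
    ∀ x ∈ seg2 e₁ ∩ seg2 e₂, x ∈ e₁ ∧ x ∈ e₂

/-- A triangulation of `S` is a maximal plane graph on `S`. -/
def IsTriangulation {S : Finset Pt} (T : PlaneGraph S) : Prop :=
  ∀ G : PlaneGraph S, T.edges ⊆ G.edges → G.edges = T.edges

/-- `tr S`: the number of triangulations of `S`. -/
def triCount (S : Finset Pt) : ℕ :=
  Nat.card {T : PlaneGraph S // IsTriangulation T}

/-- A plane graph is a spanning cycle of `S` if its edges form a Hamiltonian
cycle on `S`. -/
def IsSpanningCycle {S : Finset Pt} (G : PlaneGraph S) : Prop :=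
  3 ≤ S.card ∧ ∃ f : Fin S.card ≃ {p : Pt // p ∈ S},
    G.edges =
      Finset.image (fun i : Fin S.card => s(((f i : Pt)), ((f (finRotate S.card i) : Pt)))) Finset.univ

/-- `sc S`: the number of crossing-free straight-edge spanning cycles of `S`. -/
def scCount (S : Finset Pt) : ℕ :=
  Nat.card {G : PlaneGraph S // IsSpanningCycle G}

/-- A plane graph is a perfect matching of `S` if every point of `S` is incident
to exactly one edge. -/
def IsPerfectMatching {S : Finset Pt} (G : PlaneGraph S) : Prop :=
  ∀ p ∈ S, ∃! e, e ∈ G.edges ∧ p ∈ e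

/-- `pm S`: the number of crossing-free straight-edge perfect matchings of `S`. -/
def pmCount (S : Finset Pt) : ℕ :=
  Nat.card {G : PlaneGraph S // IsPerfectMatching G}

/-- The support of a plane graph `G` on `S`: the number of triangulations of `S`
containing all edges of `G`. -/
def supp {S : Finset Pt} (G : PlaneGraph S) : ℕ :=
  Nat.card {T : PlaneGraph S // IsTriangulation T ∧ G.edges ⊆ T.edges}

/-- A finite set of points is in (strictly) convex position. -/
def InConvexPosition (Q : Finset Pt) : Prop :=
  ∀ p ∈ Q, p ∉ convexHull ℝ (↑(Q.erase p) : Set Pt)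

/-- `p q` is an edge of the convex hull boundary of `Q`. -/
def IsHullEdgeOf (Q : Finset Pt) (p q : Pt) : Prop :=
  p ∈ Q ∧ q ∈ Q ∧ p ≠ q ∧
    segment ℝ p q ⊆ frontier (convexHull ℝ (Q : Set Pt))

/-- `e` is a diagonal of the convex polygon with vertex set `Q`. -/
def IsDiagonalOf (Q : Finset Pt) (e : Sym2 Pt) : Prop :=
  ∃ p ∈ Q, ∃ q ∈ Q, e = s(p, q) ∧
    openSegment ℝ p q ⊆ interior (convexHull ℝ (Q : Set Pt))

/-- `F` is a set of ps-flippable (pseudo-simultaneously flippable) edges of the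
triangulation `T`: the edges of `F` are diagonals of pairwise interior-disjoint
(empty) convex polygons whose boundary edges all belong to `T`. -/
def IsPsFlippable {S : Finset Pt} (T : PlaneGraph S) (F : Finset (Sym2 Pt)) : Prop :=
  F ⊆ T.edges ∧
  ∃ 𝒬 : Finset (Finset Pt),
    (∀ Q ∈ 𝒬, ↑Q ⊆ (S : Set Pt) ∧ 3 ≤ Q.card ∧ InConvexPosition Q ∧
      (∀ p q, IsHullEdgeOf Q p q → s(p, q) ∈ T.edges) ∧
      (∀ p ∈ S, p ∉ interior (convexHull ℝ (Q : Set Pt)))) ∧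
    (∀ Q ∈ 𝒬, ∀ Q' ∈ 𝒬, Q ≠ Q' →
      interior (convexHull ℝ (Q : Set Pt)) ∩ interior (convexHull ℝ (Q' : Set Pt)) = ∅) ∧
    (∀ e ∈ F, ∃ Q ∈ 𝒬, IsDiagonalOf Q e)

/-- The drawing of a plane graph: the union of its (closed) edge segments and
its vertex set. -/
def drawing {S : Finset Pt} (G : PlaneGraph S) : Set Pt :=
  (⋃ e ∈ G.edges, seg2 e) ∪ (S : Set Pt)

/-- A convex decomposition of `S`: a plane graph containing all convex hull
boundary edges, whose bounded faces are all convex, and with no isolated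
vertices. -/
def IsConvexDecomposition {S : Finset Pt} (D : PlaneGraph S) : Prop :=
  (∀ p q, IsHullEdgeOf S p q → s(p, q) ∈ D.edges) ∧
  (∀ x ∉ drawing D, Bornology.IsBounded (connectedComponentIn (drawing D)ᶜ x) →
    Convex ℝ (connectedComponentIn (drawing D)ᶜ x)) ∧
  (∀ p ∈ S, ∃ e ∈ D.edges, p ∈ e)

/-- `p` is an interior vertex of `S` (not on the convex hull boundary). -/
def InteriorVtx (S : Finset Pt) (p : Pt) : Prop :=
  p ∈ S ∧ p ∉ frontier (convexHull ℝ (S : Set Pt))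

/-- `p` has a valid triple of edges in `G`. -/
def IsValidAt {S : Finset Pt} (G : PlaneGraph S) (p : Pt) : Prop :=
  ∃ a ∈ S, ∃ b ∈ S, ∃ c ∈ S,
    p ∈ convexHull ℝ ({a, b, c} : Set Pt) ∧
    s(p, a) ∈ G.edges ∧ s(p, b) ∈ G.edges ∧ s(p, c) ∈ G.edges

/-- The degree of a point in a plane graph. -/
def degree {S : Finset Pt} (G : PlaneGraph S) (p : Pt) : ℕ :=
  (G.edges.filter (fun e => p ∈ e)).card

/-- `a b c` span a triangular face of the triangulation `T`. -/
def IsTriFace {S : Finset Pt} (T : PlaneGraph S) (a b c : Pt) : Prop :=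
  a ∈ S ∧ b ∈ S ∧ c ∈ S ∧
  s(a, b) ∈ T.edges ∧ s(b, c) ∈ T.edges ∧ s(a, c) ∈ T.edges ∧
  ∀ p ∈ S, p ∉ interior (convexHull ℝ ({a, b, c} : Set Pt))

/-- An edge of a triangulation is flippable if its two incident triangles form
a convex quadrilateral. -/
def IsFlippable {S : Finset Pt} (T : PlaneGraph S) (e : Sym2 Pt) : Prop :=
  e ∈ T.edges ∧ ∃ a b c d : Pt, e = s(a, b) ∧ c ≠ d ∧
    IsTriFace T a b c ∧ IsTriFace T a b d ∧
    (openSegment ℝ a b ∩ openSegment ℝ c d).Nonempty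

/-- `flip T`: the number of flippable edges of `T`. -/
def flipCount {S : Finset Pt} (T : PlaneGraph S) : ℕ :=
  (T.edges.filter (fun e => IsFlippable T e)).card

/-- `v3 T`: the number of interior vertices of degree 3 in `T`. -/
def v3 {S : Finset Pt} (T : PlaneGraph S) : ℕ :=
  (S.filter (fun p => p ∉ frontier (convexHull ℝ (S : Set Pt)) ∧ degree T p = 3)).card

/-- The number of vertices of `S` on its convex hull boundary. -/
def hullVtxCount (S : Finset Pt) : ℕ :=
  (S.filter (fun p => p ∈ frontier (convexHull ℝ (S : Set Pt)))).card

/-- Orientation determinant. -/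
def ori (a b c : Pt) : ℝ := (b.1 - a.1) * (c.2 - a.2) - (b.2 - a.2) * (c.1 - a.1)

/-- strict interior of a triangle, in barycentric coordinates -/
def InT (p x c s : Pt) : Prop :=
  ∃ α β γ : ℝ, 0 < α ∧ 0 < β ∧ 0 < γ ∧ α + β + γ = 1 ∧
    s.1 = α * p.1 + β * x.1 + γ * c.1 ∧ s.2 = α * p.2 + β * x.2 + γ * c.2

theorem mem_seg (a b x : Pt) : x ∈ segment ℝ a b ↔
    ∃ t : ℝ, 0 ≤ t ∧ t ≤ 1 ∧ x.1 = (1 - t) * a.1 + t * b.1 ∧ x.2 = (1 - t) * a.2 + t * b.2 := by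
  rw [segment_eq_image]
  constructor
  · rintro ⟨t, ⟨h0, h1⟩, rfl⟩
    exact ⟨t, h0, h1, by simp, by simp⟩
  · rintro ⟨t, h0, h1, h2, h3⟩
    exact ⟨t, ⟨h0, h1⟩, Prod.ext (by simp [h2]) (by simp [h3])⟩

theorem mem_oseg (a b x : Pt) : x ∈ openSegment ℝ a b ↔
    ∃ t : ℝ, 0 < t ∧ t < 1 ∧ x.1 = (1 - t) * a.1 + t * b.1 ∧ x.2 = (1 - t) * a.2 + t * b.2 := by
  rw [openSegment_eq_image]
  constructor
  · rintro ⟨t, ⟨h0, h1⟩, rfl⟩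
    exact ⟨t, h0, h1, by simp, by simp⟩
  · rintro ⟨t, h0, h1, h2, h3⟩
    exact ⟨t, ⟨h0, h1⟩, Prod.ext (by simp [h2]) (by simp [h3])⟩

theorem ori_comb (a b u v x : Pt) (t : ℝ) (h1 : x.1 = (1 - t) * u.1 + t * v.1)
    (h2 : x.2 = (1 - t) * u.2 + t * v.2) :
    ori a b x = (1 - t) * ori a b u + t * ori a b v := by
  unfold ori; rw [h1, h2]; ring

theorem ori_comb3 (a b p x c s : Pt) (α β γ : ℝ) (h : α + β + γ = 1)
    (h1 : s.1 = α * p.1 + β * x.1 + γ * c.1) (h2 : s.2 = α * p.2 + β * x.2 + γ * c.2) :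
    ori a b s = α * ori a b p + β * ori a b x + γ * ori a b c := by
  have : α = 1 - β - γ := by linarith
  subst this
  unfold ori; rw [h1, h2]; ring

theorem ori_cyc (a b c : Pt) : ori b c a = ori a b c := by unfold ori; ring
theorem ori_cyc2 (a b c : Pt) : ori c a b = ori a b c := by unfold ori; ring
theorem ori_swap (a b c : Pt) : ori b a c = - ori a b c := by unfold ori; ring
theorem ori_swap2 (a b c : Pt) : ori a c b = - ori a b c := by unfold ori; ring
theorem ori_aab (a b : Pt) : ori a a b = 0 := by unfold ori; ring
theorem ori_aba (a b : Pt) : ori a b a = 0 := by unfold ori; ring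
theorem ori_abb (a b : Pt) : ori a b b = 0 := by unfold ori; ring

/-- affine coordinates along a line -/
theorem ori_zero_line (a b c : Pt) (hab : a ≠ b) (h : ori a b c = 0) :
    ∃ t : ℝ, c.1 = (1 - t) * a.1 + t * b.1 ∧ c.2 = (1 - t) * a.2 + t * b.2 := by
  unfold ori at h
  by_cases h1 : b.1 - a.1 = 0
  · have h2 : b.2 - a.2 ≠ 0 := by
      intro h2
      exact hab (Prod.ext (by linarith) (by linarith))
    refine ⟨(c.2 - a.2) / (b.2 - a.2), ?_, ?_⟩
    · have : c.1 - a.1 = 0 := by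
        rw [h1] at h
        have : (b.2 - a.2) * (c.1 - a.1) = 0 := by linarith
        rcases mul_eq_zero.1 this with h | h
        · exact absurd h h2
        · exact h
      have e : b.1 = a.1 := by linarith
      rw [e]; ring_nf; linarith
    · field_simp; ring
  · refine ⟨(c.1 - a.1) / (b.1 - a.1), ?_, ?_⟩
    · field_simp; ring
    · field_simp; linarith

theorem genpos_ori {S : Finset Pt} (hS : GenPos S) {a b c : Pt} (ha : a ∈ S) (hb : b ∈ S)
    (hc : c ∈ S) (hab : a ≠ b) (hac : a ≠ c) (hbc : b ≠ c) : ori a b c ≠ 0 := by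
  intro h
  apply hS a ha b hb c hc hab hac hbc
  obtain ⟨t, h1, h2⟩ := ori_zero_line a b c hab h
  rw [collinear_iff_of_mem (p₀ := a) (by simp)]
  refine ⟨b - a, ?_⟩
  intro x hx
  simp only [Set.mem_insert_iff, Set.mem_singleton_iff] at hx
  rcases hx with rfl | rfl | rfl
  · exact ⟨0, by simp⟩
  · exact ⟨1, by simp⟩
  · refine ⟨t, Prod.ext ?_ ?_⟩
    · simp [h1]; ring
    · simp [h2]; ring

theorem seg2_mk (a b : Pt) : seg2 s(a, b) = segment ℝ a b := rfl

/-- in general position, collinearity with two points forces equality -/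
theorem genpos_eq {S : Finset Pt} (hS : GenPos S) {a b c : Pt} (ha : a ∈ S) (hb : b ∈ S)
    (hc : c ∈ S) (hab : a ≠ b) (h : ori a b c = 0) : c = a ∨ c = b := by
  by_contra hcon
  push Not at hcon
  exact genpos_ori hS ha hb hc hab hcon.1.symm hcon.2.symm h

theorem seg_ori (a b x : Pt) (h : x ∈ segment ℝ a b) : ori a b x = 0 := by
  obtain ⟨t, _, _, h1, h2⟩ := (mem_seg _ _ _).1 h
  rw [ori_comb a b a b x t h1 h2, ori_aba, ori_abb]; ring

theorem oseg_sub (a b x : Pt) (h : x ∈ openSegment ℝ a b) : x ∈ segment ℝ a b :=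
  openSegment_subset_segment ℝ a b h

theorem edge_mem_left {S : Finset Pt} (T : PlaneGraph S) {a b : Pt} (h : s(a, b) ∈ T.edges) :
    a ∈ S := T.endpoint_mem _ h a (by simp)
theorem edge_mem_right {S : Finset Pt} (T : PlaneGraph S) {a b : Pt} (h : s(a, b) ∈ T.edges) :
    b ∈ S := T.endpoint_mem _ h b (by simp)
theorem edge_ne {S : Finset Pt} (T : PlaneGraph S) {a b : Pt} (h : s(a, b) ∈ T.edges) :
    a ≠ b := by
  have := T.not_isDiag _ h
  simpa using this
theorem edge_symm {S : Finset Pt} (T : PlaneGraph S) {a b : Pt} (h : s(a, b) ∈ T.edges) :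
    s(b, a) ∈ T.edges := by rwa [Sym2.eq_swap]

/-- a point of `S` on a segment between points of `S` is an endpoint -/
theorem pt_on_seg {S : Finset Pt} (hS : GenPos S) {u v x : Pt} (hu : u ∈ S) (hv : v ∈ S)
    (hx : x ∈ S) (huv : u ≠ v) (h : x ∈ segment ℝ u v) : x = u ∨ x = v :=
  genpos_eq hS hu hv hx huv (seg_ori _ _ _ h)

theorem noncross {S : Finset Pt} (T : PlaneGraph S) {a b u v x : Pt} (h1 : s(a, b) ∈ T.edges)
    (h2 : s(u, v) ∈ T.edges) (hx1 : x ∈ segment ℝ a b) (hx2 : x ∈ segment ℝ u v) :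
    s(a, b) = s(u, v) ∨ ((x = a ∨ x = b) ∧ (x = u ∨ x = v)) := by
  by_cases h : s(a, b) = s(u, v)
  · exact Or.inl h
  · right
    have := T.noncrossing _ h1 _ h2 h x ⟨hx1, hx2⟩
    simpa using this

/-- adding an uncrossed edge -/
def addEdge {S : Finset Pt} (hS : GenPos S) (D : PlaneGraph S) (p q : Pt) (hp : p ∈ S) (hq : q ∈ S)
    (hpq : p ≠ q)
    (h : ∀ u v, s(u, v) ∈ D.edges → s(u, v) ≠ s(p, q) →
      ∀ x ∈ openSegment ℝ p q, x ∉ segment ℝ u v) : PlaneGraph S where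
  edges := insert s(p, q) D.edges
  endpoint_mem := by
    intro e he x hx
    rcases Finset.mem_insert.1 he with rfl | he
    · simp at hx; rcases hx with rfl | rfl <;> assumption
    · exact D.endpoint_mem e he x hx
  not_isDiag := by
    intro e he
    rcases Finset.mem_insert.1 he with rfl | he
    · simpa using hpq
    · exact D.not_isDiag e he
  noncrossing := by
    have key : ∀ e ∈ D.edges, e ≠ s(p, q) → ∀ x ∈ segment ℝ p q, x ∈ seg2 e → (x = p ∨ x = q) ∧ x ∈ e := by
      intro e he hne x hx hxe
      induction e with
      | _ u v =>
        have hx' : x = p ∨ x = q := by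
          by_contra hc
          push Not at hc
          exact h u v he hne x (mem_openSegment_of_ne_left_right hc.1.symm hc.2.symm hx) hxe
        refine ⟨hx', ?_⟩
        have hxS : x ∈ S := by rcases hx' with rfl | rfl <;> assumption
        have := pt_on_seg hS (edge_mem_left D he) (edge_mem_right D he) hxS (edge_ne D he) hxe
        simpa using this
    intro e₁ h₁ e₂ h₂ hne x hx
    rcases Finset.mem_insert.1 h₁ with rfl | h₁
    · rcases Finset.mem_insert.1 h₂ with rfl | h₂
      · exact absurd rfl hne
      · have := key e₂ h₂ hne.symm x hx.1 hx.2
        simpa using this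
    · rcases Finset.mem_insert.1 h₂ with rfl | h₂
      · have := key e₁ h₁ hne x hx.2 hx.1
        simpa [and_comm] using this
      · exact D.noncrossing e₁ h₁ e₂ h₂ hne x hx

theorem max_edge {S : Finset Pt} (hS : GenPos S) (T : PlaneGraph S) (hT : IsTriangulation T)
    {p q : Pt} (hp : p ∈ S) (hq : q ∈ S) (hpq : p ≠ q)
    (h : ∀ u v, s(u, v) ∈ T.edges → s(u, v) ≠ s(p, q) →
      ∀ x ∈ openSegment ℝ p q, x ∉ segment ℝ u v) : s(p, q) ∈ T.edges := by
  have := hT (addEdge hS T p q hp hq hpq h) (Finset.subset_insert _ _)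
  rw [← this]
  exact Finset.mem_insert_self _ _

theorem bary (p x c s : Pt) (h : ori p x c ≠ 0) :
    s.1 = (ori x c s / ori p x c) * p.1 + (ori c p s / ori p x c) * x.1 + (ori p x s / ori p x c) * c.1 ∧
    s.2 = (ori x c s / ori p x c) * p.2 + (ori c p s / ori p x c) * x.2 + (ori p x s / ori p x c) * c.2 ∧
    ori x c s / ori p x c + ori c p s / ori p x c + ori p x s / ori p x c = 1 := by
  refine ⟨?_, ?_, ?_⟩
  · field_simp; unfold ori; ring
  · field_simp; unfold ori; ring
  · field_simp; unfold ori; ring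

/-- if an edge `u v` meets the open segment `p c` then, unless the edge is `p c`,
the endpoints are off the line -/
theorem cross_off {S : Finset Pt} (hS : GenPos S) {p c u v y : Pt} (hp : p ∈ S) (hc : c ∈ S)
    (hu : u ∈ S) (hv : v ∈ S) (hpc : p ≠ c) (hne : s(u, v) ≠ s(p, c)) (huv : u ≠ v)
    (hy : y ∈ openSegment ℝ p c) (hyu : y ∈ segment ℝ u v) : ori p c u ≠ 0 := by
  intro h0
  have hy0 := seg_ori _ _ _ (oseg_sub _ _ _ hy)
  obtain ⟨t, ht0, ht1, h1, h2⟩ := (mem_seg _ _ _).1 hyu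
  have hyne : y ≠ u := by
    rintro rfl
    obtain ⟨r, hr0, hr1, h3, h4⟩ := (mem_oseg _ _ _).1 hy
    rcases genpos_eq hS hp hc hu hpc h0 with rfl | rfl
    · apply hpc
      apply Prod.ext
      · have : r * (c.1 - y.1) = 0 := by linarith
        rcases mul_eq_zero.1 this with h | h <;> linarith
      · have : r * (c.2 - y.2) = 0 := by linarith
        rcases mul_eq_zero.1 this with h | h <;> linarith
    · apply hpc
      apply Prod.ext
      · have : (1 - r) * (y.1 - p.1) = 0 := by linarith
        rcases mul_eq_zero.1 this with h | h <;> linarith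
      · have : (1 - r) * (y.2 - p.2) = 0 := by linarith
        rcases mul_eq_zero.1 this with h | h <;> linarith
  have ht : t ≠ 0 := by
    rintro rfl
    apply hyne
    exact Prod.ext (by linarith) (by linarith)
  have := ori_comb p c u v y t h1 h2
  rw [hy0, h0] at this
  have hv0 : ori p c v = 0 := by
    have : t * ori p c v = 0 := by linarith
    rcases mul_eq_zero.1 this with h | h
    · exact absurd h ht
    · exact h
  rcases genpos_eq hS hp hc hu hpc h0 with rfl | rfl <;>
  rcases genpos_eq hS hp hc hv hpc hv0 with rfl | rfl
  · exact huv rfl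
  · exact hne rfl
  · exact hne Sym2.eq_swap
  · exact huv rfl

/-- first crossing along `p c` -/
theorem first_cross {S : Finset Pt} (hS : GenPos S) (T : PlaneGraph S) (hT : IsTriangulation T)
    {p c : Pt} (hp : p ∈ S) (hc : c ∈ S) (hpc : p ≠ c) (hn : s(p, c) ∉ T.edges) :
    ∃ y u v, s(u, v) ∈ T.edges ∧ y ∈ openSegment ℝ p c ∧ y ∈ segment ℝ u v ∧
      ∀ u' v', s(u', v') ∈ T.edges → ∀ z ∈ openSegment ℝ p y, z ∉ segment ℝ u' v' := by
  set F : ℝ → Pt := fun t => ((1 - t) * p.1 + t * c.1, (1 - t) * p.2 + t * c.2) with hF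
  have hFc : Continuous F := by fun_prop
  set U : Set Pt := ⋃ e ∈ (T.edges.filter (fun e => p ∉ e)), seg2 e with hU
  have hUc : IsClosed U := by
    apply Set.Finite.isClosed_biUnion (Finset.finite_toSet _)
    intro e _
    induction e with
    | _ u v =>
      rw [seg2_mk, segment_eq_image]
      apply IsCompact.isClosed
      apply isCompact_Icc.image
      fun_prop
  have hK : IsCompact (Set.Icc (0:ℝ) 1 ∩ F ⁻¹' U) :=
    isCompact_Icc.inter_right (hUc.preimage hFc)
  have hnp : ∀ u v, s(u, v) ∈ T.edges → ∀ y ∈ openSegment ℝ p c, y ∈ segment ℝ u v → p ∉ s(u, v) := by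
    intro u v huv y hy hyu hpu
    have hne : s(u, v) ≠ s(p, c) := by rintro h; rw [h] at huv; exact hn huv
    rcases Sym2.mem_iff.1 hpu with rfl | rfl
    · exact cross_off hS hp hc hp (edge_mem_right T huv) hpc hne (edge_ne T huv) hy hyu (ori_aba _ _)
    · exact cross_off hS hp hc hp (edge_mem_left T huv) hpc (by rwa [Sym2.eq_swap]) (edge_ne T huv).symm hy
        (by rwa [segment_symm]) (ori_aba _ _)
  have hne : ∃ u v, s(u, v) ∈ T.edges ∧ ∃ y ∈ openSegment ℝ p c, y ∈ segment ℝ u v := by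
    by_contra hcon
    push Not at hcon
    exact hn (max_edge hS T hT hp hc hpc (fun u v huv _ x hx => hcon u v huv x hx))
  obtain ⟨u, v, huv, y, hy, hyu⟩ := hne
  obtain ⟨t, ht0, ht1, h1, h2⟩ := (mem_oseg _ _ _).1 hy
  have hFt : F t = y := Prod.ext h1.symm h2.symm
  have htK : t ∈ Set.Icc (0:ℝ) 1 ∩ F ⁻¹' U := by
    refine ⟨⟨ht0.le, ht1.le⟩, ?_⟩
    simp only [Set.mem_preimage, hFt, hU, Set.mem_iUnion]
    exact ⟨s(u, v), by simp only [Finset.mem_filter]; exact ⟨huv, hnp u v huv y hy hyu⟩, hyu⟩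
  obtain ⟨r, hrK, hr⟩ := hK.exists_isLeast ⟨t, htK⟩
  have hrt : r ≤ t := hr htK
  obtain ⟨⟨hr0, hr1⟩, hrU⟩ := hrK
  simp only [Set.mem_preimage, hU, Set.mem_iUnion] at hrU
  obtain ⟨e, he, hre⟩ := hrU
  simp only [Finset.mem_filter] at he
  induction e with
  | _ a b =>
    have hrne : r ≠ 0 := by
      rintro rfl
      have : F 0 = p := by simp [hF]
      rw [this] at hre
      have := pt_on_seg hS (edge_mem_left T he.1) (edge_mem_right T he.1) hp (edge_ne T he.1) hre
      exact he.2 (by simpa using this)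
    have hrpos : 0 < r := lt_of_le_of_ne hr0 (Ne.symm hrne)
    refine ⟨F r, a, b, he.1, (mem_oseg _ _ _).2 ⟨r, hrpos, by linarith, rfl, rfl⟩, hre, ?_⟩
    intro u' v' h' z hz hz'
    obtain ⟨w, hw0, hw1, h3, h4⟩ := (mem_oseg _ _ _).1 hz
    have hzF : z = F (w * r) := Prod.ext (by rw [h3]; simp [hF]; ring) (by rw [h4]; simp [hF]; ring)
    have hwr : w * r < r := by nlinarith
    have hwr0 : 0 < w * r := by positivity
    have hzo : z ∈ openSegment ℝ p c := by
      rw [hzF]; exact (mem_oseg _ _ _).2 ⟨w * r, hwr0, by linarith, rfl, rfl⟩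
    have : w * r ∈ Set.Icc (0:ℝ) 1 ∩ F ⁻¹' U := by
      refine ⟨⟨hwr0.le, by linarith⟩, ?_⟩
      simp only [Set.mem_preimage, ← hzF, hU, Set.mem_iUnion]
      exact ⟨s(u', v'), by simp only [Finset.mem_filter]; exact ⟨h', hnp u' v' h' z hzo hz'⟩, hz'⟩
    have := hr this
    linarith


/-- moving from inside a triangle to a point not inside, one meets the boundary -/
theorem exit3 (f g h : Pt → ℝ) (y w : Pt) 
    (hf : ∀ t : ℝ, f ((1 - t) * y.1 + t * w.1, (1 - t) * y.2 + t * w.2) = (1 - t) * f y + t * f w)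
    (hg : ∀ t : ℝ, g ((1 - t) * y.1 + t * w.1, (1 - t) * y.2 + t * w.2) = (1 - t) * g y + t * g w)
    (hh : ∀ t : ℝ, h ((1 - t) * y.1 + t * w.1, (1 - t) * y.2 + t * w.2) = (1 - t) * h y + t * h w)
    (fy : 0 < f y) (gy : 0 < g y) (hy : 0 < h y) (hw : ¬ (0 < f w ∧ 0 < g w ∧ 0 < h w)) :
    ∃ z ∈ segment ℝ y w, 0 ≤ f z ∧ 0 ≤ g z ∧ 0 ≤ h z ∧ (f z = 0 ∨ g z = 0 ∨ h z = 0) := by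
  set m : ℝ → ℝ := fun t => min ((1 - t) * f y + t * f w)
    (min ((1 - t) * g y + t * g w) ((1 - t) * h y + t * h w)) with hm
  have hmc : ContinuousOn m (Set.Icc 0 1) := by
    apply Continuous.continuousOn
    fun_prop
  have h0 : 0 ≤ m 0 := by simp [hm, fy.le, gy.le, hy.le]
  have h1 : m 1 ≤ 0 := by
    simp only [hm, sub_self, zero_mul, one_mul, zero_add]
    by_contra hc
    push Not at hc
    exact hw ⟨(lt_min_iff.1 hc).1, lt_min_iff.1 (lt_min_iff.1 hc).2⟩
  obtain ⟨t, ⟨ht0, ht1⟩, ht⟩ := intermediate_value_Icc' (zero_le_one' ℝ) hmc ⟨h1, h0⟩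
  refine ⟨((1 - t) * y.1 + t * w.1, (1 - t) * y.2 + t * w.2),
    (mem_seg _ _ _).2 ⟨t, ht0, ht1, rfl, rfl⟩, ?_⟩
  rw [hf, hg, hh]
  have e1 : m t ≤ (1 - t) * f y + t * f w := min_le_left _ _
  have e2 : m t ≤ (1 - t) * g y + t * g w := (min_le_right _ _).trans (min_le_left _ _)
  have e3 : m t ≤ (1 - t) * h y + t * h w := (min_le_right _ _).trans (min_le_right _ _)
  rw [ht] at e1 e2 e3
  refine ⟨e1, e2, e3, ?_⟩
  rcases min_choice ((1 - t) * f y + t * f w)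
    (min ((1 - t) * g y + t * g w) ((1 - t) * h y + t * h w)) with hc | hc
  · left; rw [← hc]; exact ht
  · right
    rcases min_choice ((1 - t) * g y + t * g w) ((1 - t) * h y + t * h w) with hd | hd
    · left; rw [← hd, ← hc]; exact ht
    · right; rw [← hd, ← hc]; exact ht

theorem ori_aff (a b y w : Pt) (t : ℝ) :
    ori a b ((1 - t) * y.1 + t * w.1, (1 - t) * y.2 + t * w.2) = (1 - t) * ori a b y + t * ori a b w :=
  ori_comb a b y w _ t rfl rfl

/-- the corner hypothesis -/
def CornerHyp {S : Finset Pt} (T : PlaneGraph S) (p x c : Pt) : Prop :=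
  ∀ u v, s(u, v) ∈ T.edges → s(u, v) ≠ s(p, c) → (∃ y ∈ openSegment ℝ p c, y ∈ segment ℝ u v) →
    ∀ z ∈ segment ℝ u v, z ∉ segment ℝ p x ∧ z ∉ segment ℝ x c

theorem seg_sub {a b x y z : Pt} (hx : x ∈ segment ℝ a b) (hy : y ∈ segment ℝ a b)
    (hz : z ∈ segment ℝ x y) : z ∈ segment ℝ a b :=
  (convex_segment a b).segment_subset hx hy hz

theorem cross_off' {S : Finset Pt} (hS : GenPos S) {p c u v y : Pt} (hp : p ∈ S) (hc : c ∈ S)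
    (hu : u ∈ S) (hv : v ∈ S) (hpc : p ≠ c) (hne : s(u, v) ≠ s(p, c)) (huv : u ≠ v)
    (hy : y ∈ openSegment ℝ p c) (hyu : y ∈ segment ℝ u v) : ori p c v ≠ 0 :=
  cross_off hS hp hc hv hu hpc (by rwa [Sym2.eq_swap]) huv.symm hy (by rwa [segment_symm])

theorem corner_hyp {S : Finset Pt} (hS : GenPos S) (T : PlaneGraph S)
    {p y w z : Pt} (hp : p ∈ S) (hwz : s(w, z) ∈ T.edges) (hpw : p ≠ w) (hpz : p ≠ z)
    (hyS : y ∉ S) (hy : y ∈ segment ℝ w z)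
    (hfirst : ∀ u' v', s(u', v') ∈ T.edges → ∀ ζ ∈ openSegment ℝ p y, ζ ∉ segment ℝ u' v') :
    CornerHyp T p y w := by
  intro u v huv hne ⟨y', hy', hyuv⟩ ζ hζ
  have hw := edge_mem_left T hwz
  have offu := cross_off hS hp hw (edge_mem_left T huv) (edge_mem_right T huv) hpw hne (edge_ne T huv) hy' hyuv
  have offv := cross_off' hS hp hw (edge_mem_left T huv) (edge_mem_right T huv) hpw hne (edge_ne T huv) hy' hyuv
  have second : ζ ∉ segment ℝ y w := by
    intro hζ2
    have hζ3 : ζ ∈ segment ℝ w z := seg_sub hy (left_mem_segment ℝ w z) hζ2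
    rcases noncross T huv hwz hζ hζ3 with h | ⟨h1, h2⟩
    · rcases Sym2.eq_iff.1 h with ⟨rfl, rfl⟩ | ⟨rfl, rfl⟩
      · exact offu (ori_abb _ _)
      · exact offv (ori_abb _ _)
    · rcases h2 with rfl | rfl
      · rcases h1 with rfl | rfl
        · exact offu (ori_abb _ _)
        · exact offv (ori_abb _ _)
      · apply hyS
        obtain ⟨t, ht0, ht1, h3, h4⟩ := (mem_seg _ _ _).1 hy
        obtain ⟨s, hs0, hs1, h5, h6⟩ := (mem_seg _ _ _).1 hζ2
        have hwζ := edge_ne T hwz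
        have e : (1 - s) * t = 1 := by
          by_contra hcon
          have hk : 1 - (1 - s) * t ≠ 0 := fun h => hcon (by linarith)
          apply hwζ
          apply Prod.ext
          · have : (1 - (1 - s) * t) * (ζ.1 - w.1) = 0 := by rw [h3] at h5; linear_combination h5
            rcases mul_eq_zero.1 this with h | h
            · exact absurd h hk
            · linarith
          · have : (1 - (1 - s) * t) * (ζ.2 - w.2) = 0 := by rw [h4] at h6; linear_combination h6
            rcases mul_eq_zero.1 this with h | h
            · exact absurd h hk
            · linarith
        have ht : t = 1 := by nlinarith
        have : y = ζ := by
          apply Prod.ext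
          · rw [h3, ht]; ring
          · rw [h4, ht]; ring
        rw [this]; exact edge_mem_right T hwz
  refine ⟨?_, second⟩
  intro hζ1
  by_cases h1 : ζ = p
  · subst h1
    rcases pt_on_seg hS (edge_mem_left T huv) (edge_mem_right T huv) hp (edge_ne T huv) hζ with rfl | rfl
    · exact offu (ori_aba _ _)
    · exact offv (ori_aba _ _)
  · by_cases h2 : ζ = y
    · subst h2; exact second (left_mem_segment ℝ _ _)
    · exact hfirst u v huv ζ (mem_openSegment_of_ne_left_right (Ne.symm h1) (Ne.symm h2) hζ1) hζ

theorem oseg_notMem {S : Finset Pt} (hS : GenPos S) {p c y : Pt} (hp : p ∈ S) (hc : c ∈ S)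
    (hpc : p ≠ c) (hy : y ∈ openSegment ℝ p c) : y ∉ S := by
  intro hyS
  rcases pt_on_seg hS hp hc hyS hpc (oseg_sub _ _ _ hy) with rfl | rfl
  · exact hpc (left_mem_openSegment_iff.1 hy)
  · exact hpc (right_mem_openSegment_iff.1 hy)

theorem corner {S : Finset Pt} (hS : GenPos S) (T : PlaneGraph S) (hT : IsTriangulation T)
    {p : Pt} (hp : p ∈ S) : ∀ n : ℕ, ∀ x c : Pt, c ∈ S → ori p x c ≠ 0 →
    (S.filter (fun s => InT p x c s)).card ≤ n → CornerHyp T p x c →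
    ∃ c' ∈ S, s(p, c') ∈ T.edges ∧ (c' = c ∨ InT p x c c') := by
  intro n
  induction n using Nat.strong_induction_on with
  | _ n ih =>
  intro x c hc hΔ hn hyp
  have hpc : p ≠ c := by rintro rfl; exact hΔ (ori_aba _ _)
  by_cases hT' : s(p, c) ∈ T.edges
  · exact ⟨c, hc, hT', Or.inl rfl⟩
  obtain ⟨y, u, v, huv, hy, hyu, hfirst⟩ := first_cross hS T hT hp hc hpc hT'
  have hne : s(u, v) ≠ s(p, c) := by rintro h; rw [h] at huv; exact hT' huv
  -- the endpoint on the side of x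
  obtain ⟨w, z, hwz, hyw, hside⟩ : ∃ w z, s(w, z) ∈ T.edges ∧ y ∈ segment ℝ w z ∧
      0 < ori c p w / ori p x c := by
    have e1 := cross_off hS hp hc (edge_mem_left T huv) (edge_mem_right T huv) hpc hne (edge_ne T huv) hy hyu
    have e2 := cross_off' hS hp hc (edge_mem_left T huv) (edge_mem_right T huv) hpc hne (edge_ne T huv) hy hyu
    have hy0 := seg_ori _ _ _ (oseg_sub _ _ _ hy)
    obtain ⟨t, ht0, ht1, h1, h2⟩ := (mem_seg _ _ _).1 hyu
    have h3 := ori_comb c p u v y t h1 h2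
    rw [ori_swap, hy0] at h3
    have e1' : ori c p u / ori p x c ≠ 0 := div_ne_zero (by rw [ori_swap]; exact neg_ne_zero.2 e1) hΔ
    have e2' : ori c p v / ori p x c ≠ 0 := div_ne_zero (by rw [ori_swap]; exact neg_ne_zero.2 e2) hΔ
    have h4 : (1 - t) * (ori c p u / ori p x c) + t * (ori c p v / ori p x c) = 0 := by
      have : (1 - t) * (ori c p u / ori p x c) + t * (ori c p v / ori p x c) =
        ((1 - t) * ori c p u + t * ori c p v) / ori p x c := by ring
      rw [this, ← h3]; simp
    rcases lt_or_gt_of_ne e1' with h | h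
    · refine ⟨v, u, edge_symm T huv, by rwa [segment_symm], ?_⟩
      by_contra hcon
      have h5 : ori c p v / ori p x c < 0 := lt_of_le_of_ne (not_lt.1 hcon) e2'
      rcases eq_or_lt_of_le ht0 with h6 | h6
      · rw [← h6] at h4; linarith
      · nlinarith
    · exact ⟨u, v, huv, hyu, h⟩
  have hyS : y ∉ S := oseg_notMem hS hp hc hpc hy
  have hne' : s(w, z) ≠ s(p, c) := by rintro h; rw [h] at hwz; exact hT' hwz
  have offw := cross_off hS hp hc (edge_mem_left T hwz) (edge_mem_right T hwz) hpc hne' (edge_ne T hwz) hy hyw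
  have offz := cross_off' hS hp hc (edge_mem_left T hwz) (edge_mem_right T hwz) hpc hne' (edge_ne T hwz) hy hyw
  have hpw : p ≠ w := by rintro rfl; exact offw (ori_aba _ _)
  have hpz : p ≠ z := by rintro rfl; exact offz (ori_aba _ _)
  obtain ⟨r, hr0, hr1, hr2, hr3⟩ := (mem_oseg _ _ _).1 hy
  have hyp' := corner_hyp hS T hp hwz hpw hpz hyS hyw hfirst
  have hΔ' : ori p y w ≠ 0 := by
    have : ori p y w = r * ori p c w := by unfold ori; rw [hr2, hr3]; ring
    rw [this]; exact mul_ne_zero hr0.ne' offw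
  -- w is interior
  have hyα : ori x c y / ori p x c = 1 - r := by
    rw [ori_comb x c p c y r hr2 hr3, ori_abb, ori_cyc]; field_simp; ring
  have hyγ : ori p x y / ori p x c = r := by
    rw [ori_comb p x p c y r hr2 hr3, ori_aba]; field_simp; ring
  have hwI : InT p x c w := by
    obtain ⟨b1, b2, b3⟩ := bary p x c w hΔ
    by_contra hcon
    have hnot : ¬ (0 < ori x c w / ori p x c ∧ 0 < ori p x w / ori p x c ∧ 0 < (1:ℝ)) := by
      rintro ⟨k1, k2, -⟩
      exact hcon ⟨_, _, _, k1, hside, k2, b3, b1, b2⟩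
    obtain ⟨ζ, hζ, k1, k2, -, k3⟩ := exit3 (fun s => ori x c s / ori p x c) (fun s => ori p x s / ori p x c)
      (fun _ => 1) y w (by intro t; simp only [ori_aff]; ring) (by intro t; simp only [ori_aff]; ring)
      (by intro t; ring) (by simp only [hyα]; linarith) (by simp only [hyγ]; linarith) one_pos hnot
    have hζuv : ζ ∈ segment ℝ w z := seg_sub hyw (left_mem_segment ℝ _ _) hζ
    obtain ⟨n1, n2⟩ := hyp w z hwz hne' ⟨y, hy, hyw⟩ ζ hζuv
    obtain ⟨τ, hτ0, hτ1, hτ2, hτ3⟩ := (mem_seg _ _ _).1 hζ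
    have hβ : 0 ≤ ori c p ζ / ori p x c := by
      rw [ori_comb c p y w ζ τ hτ2 hτ3, ori_swap p c y, seg_ori _ _ _ (oseg_sub _ _ _ hy)]
      have : ((1 - τ) * -0 + τ * ori c p w) / ori p x c = τ * (ori c p w / ori p x c) := by ring
      rw [this]; positivity
    obtain ⟨c1, c2, c3⟩ := bary p x c ζ hΔ
    rcases k3 with k3 | k3 | k3
    · apply n2
      rw [k3] at c1 c2 c3
      exact (mem_seg _ _ _).2 ⟨_, k2, by linarith, by rw [c1, ← c3]; ring, by rw [c2, ← c3]; ring⟩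
    · apply n1
      rw [k3] at c1 c2 c3
      exact (mem_seg _ _ _).2 ⟨_, hβ, by linarith, by rw [c1, ← c3]; ring, by rw [c2, ← c3]; ring⟩
    · linarith
  have hsub : ∀ s, InT p y w s → InT p x c s := by
    rintro s ⟨α, β, γ, hα, hβ, hγ, h1, h2, h3⟩
    obtain ⟨a, b, g, ha, hb, hg, h4, h5, h6⟩ := hwI
    have hr' : 0 < 1 - r := by linarith
    refine ⟨α + β * (1 - r) + γ * a, γ * b, β * r + γ * g, by positivity, by positivity, by positivity, ?_, ?_, ?_⟩
    · linear_combination h1 + γ * h4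
    · rw [h2, hr2, h5]; ring
    · rw [h3, hr3, h6]; ring
  have hwS := edge_mem_left T hwz
  have hlt : (S.filter (fun s => InT p y w s)).card < (S.filter (fun s => InT p x c s)).card := by
    apply Finset.card_lt_card
    rw [Finset.ssubset_iff_of_subset]
    · refine ⟨w, by simp [hwS, hwI], ?_⟩
      simp only [Finset.mem_filter, not_and]
      rintro - ⟨α, β, γ, hα, hβ, hγ, h1, h2, h3⟩
      have := ori_comb3 p w p y w w α β γ h1 h2 h3
      rw [ori_abb, ori_aba, ori_swap2] at this
      have : β * ori p y w = 0 := by linarith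
      rcases mul_eq_zero.1 this with h | h
      · exact hβ.ne' h
      · exact hΔ' h
    · intro s hs
      simp only [Finset.mem_filter] at hs ⊢
      exact ⟨hs.1, hsub s hs.2⟩
  obtain ⟨c', hc', hcT, h⟩ := ih _ (lt_of_lt_of_le hlt hn) y w hwS hΔ' le_rfl hyp'
  refine ⟨c', hc', hcT, Or.inr ?_⟩
  rcases h with rfl | h
  · exact hwI
  · exact hsub _ h

/-- either `p d` is an edge or it has a first crossing whose both endpoints can be used -/
theorem corner_first {S : Finset Pt} (hS : GenPos S) (T : PlaneGraph S) (hT : IsTriangulation T)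
    {p d : Pt} (hp : p ∈ S) (hd : d ∈ S) (hpd : p ≠ d) (hn : s(p, d) ∉ T.edges) :
    ∃ y w z, s(w, z) ∈ T.edges ∧ p ≠ w ∧ p ≠ z ∧ y ∈ openSegment ℝ p d ∧ y ∈ segment ℝ w z ∧
      (∃ c' ∈ S, s(p, c') ∈ T.edges ∧ (c' = w ∨ InT p y w c')) ∧
      (∃ c' ∈ S, s(p, c') ∈ T.edges ∧ (c' = z ∨ InT p y z c')) := by
  obtain ⟨y, w, z, hwz, hy, hyw, hfirst⟩ := first_cross hS T hT hp hd hpd hn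
  have hyS : y ∉ S := oseg_notMem hS hp hd hpd hy
  have hne' : s(w, z) ≠ s(p, d) := by rintro h; rw [h] at hwz; exact hn hwz
  have offw := cross_off hS hp hd (edge_mem_left T hwz) (edge_mem_right T hwz) hpd hne' (edge_ne T hwz) hy hyw
  have offz := cross_off' hS hp hd (edge_mem_left T hwz) (edge_mem_right T hwz) hpd hne' (edge_ne T hwz) hy hyw
  have hpw : p ≠ w := by rintro rfl; exact offw (ori_aba _ _)
  have hpz : p ≠ z := by rintro rfl; exact offz (ori_aba _ _)
  obtain ⟨r, hr0, hr1, hr2, hr3⟩ := (mem_oseg _ _ _).1 hy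
  have hΔ : ∀ w, ori p d w ≠ 0 → ori p y w ≠ 0 := by
    intro w offw
    have : ori p y w = r * ori p d w := by unfold ori; rw [hr2, hr3]; ring
    rw [this]; exact mul_ne_zero hr0.ne' offw
  exact ⟨y, w, z, hwz, hpw, hpz, hy, hyw,
    corner hS T hT hp _ y w (edge_mem_left T hwz) (hΔ w offw) le_rfl
      (corner_hyp hS T hp hwz hpw hpz hyS hyw hfirst),
    corner hS T hT hp _ y z (edge_mem_right T hwz) (hΔ z offz) le_rfl
      (corner_hyp hS T hp (edge_symm T hwz) hpz hpw hyS (by rwa [segment_symm]) hfirst)⟩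

/-- every non-maximal vertex in a direction has an increasing edge -/
theorem good_dir {S : Finset Pt} (hS : GenPos S) (T : PlaneGraph S) (hT : IsTriangulation T)
    (A B : ℝ) {p q : Pt} (hp : p ∈ S) (hq : q ∈ S) (h : A * p.1 + B * p.2 < A * q.1 + B * q.2) :
    ∃ c ∈ S, s(p, c) ∈ T.edges ∧ A * p.1 + B * p.2 < A * c.1 + B * c.2 := by
  have hpq : p ≠ q := by rintro rfl; exact lt_irrefl _ h
  by_cases hn : s(p, q) ∈ T.edges
  · exact ⟨q, hq, hn, h⟩
  obtain ⟨y, w, z, hwz, hpw, hpz, hy, hyw, ⟨c1, hc1, hT1, h1⟩, ⟨c2, hc2, hT2, h2⟩⟩ :=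
    corner_first hS T hT hp hq hpq hn
  obtain ⟨r, hr0, hr1, hr2, hr3⟩ := (mem_oseg _ _ _).1 hy
  have hgy : A * p.1 + B * p.2 < A * y.1 + B * y.2 := by
    rw [hr2, hr3]; nlinarith
  have main : ∀ w c1, A * p.1 + B * p.2 < A * w.1 + B * w.2 → (c1 = w ∨ InT p y w c1) →
      A * p.1 + B * p.2 < A * c1.1 + B * c1.2 := by
    rintro w c1 hw (rfl | ⟨α, β, γ, hα, hβ, hγ, k1, k2, k3⟩)
    · exact hw
    · rw [k2, k3]
      have : α = 1 - β - γ := by linarith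
      subst this
      nlinarith
  obtain ⟨t, ht0, ht1, ht2, ht3⟩ := (mem_seg _ _ _).1 hyw
  by_cases hw : A * p.1 + B * p.2 < A * w.1 + B * w.2
  · exact ⟨c1, hc1, hT1, main w c1 hw h1⟩
  · refine ⟨c2, hc2, hT2, main z c2 ?_ h2⟩
    rw [ht2, ht3] at hgy
    by_contra hz
    push Not at hw hz
    nlinarith

/-- angular extremes -/
theorem ang_min (A B : ℝ) (p : Pt) (K : Finset Pt) (hK : K.Nonempty)
    (h : ∀ c ∈ K, A * p.1 + B * p.2 < A * c.1 + B * c.2) : ∃ c ∈ K, ∀ d ∈ K, 0 ≤ ori p c d := by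
  obtain ⟨c, hc, hmin⟩ := K.exists_min_image
    (fun c => (A * (c.2 - p.2) - B * (c.1 - p.1)) / (A * (c.1 - p.1) + B * (c.2 - p.2))) hK
  refine ⟨c, hc, fun d hd => ?_⟩
  have hcp : 0 < A * (c.1 - p.1) + B * (c.2 - p.2) := by have := h c hc; linarith
  have hdp : 0 < A * (d.1 - p.1) + B * (d.2 - p.2) := by have := h d hd; linarith
  have := hmin d hd
  rw [div_le_div_iff₀ hcp hdp] at this
  have hAB : 0 < A ^ 2 + B ^ 2 := by
    by_contra hcon
    have hA : A = 0 := by nlinarith [sq_nonneg A, sq_nonneg B]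
    have hB : B = 0 := by nlinarith [sq_nonneg A, sq_nonneg B]
    rw [hA, hB] at hcp; linarith
  have e : 0 ≤ (A ^ 2 + B ^ 2) * ori p c d := by unfold ori; linarith
  exact nonneg_of_mul_nonneg_right e hAB

theorem ang_max (A B : ℝ) (p : Pt) (K : Finset Pt) (hK : K.Nonempty)
    (h : ∀ c ∈ K, A * p.1 + B * p.2 < A * c.1 + B * c.2) : ∃ c ∈ K, ∀ d ∈ K, ori p c d ≤ 0 := by
  obtain ⟨c, hc, hmin⟩ := K.exists_max_image
    (fun c => (A * (c.2 - p.2) - B * (c.1 - p.1)) / (A * (c.1 - p.1) + B * (c.2 - p.2))) hK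
  refine ⟨c, hc, fun d hd => ?_⟩
  have hcp : 0 < A * (c.1 - p.1) + B * (c.2 - p.2) := by have := h c hc; linarith
  have hdp : 0 < A * (d.1 - p.1) + B * (d.2 - p.2) := by have := h d hd; linarith
  have := hmin d hd
  rw [div_le_div_iff₀ hdp hcp] at this
  have hAB : 0 < A ^ 2 + B ^ 2 := by
    by_contra hcon
    have hA : A = 0 := by nlinarith [sq_nonneg A, sq_nonneg B]
    have hB : B = 0 := by nlinarith [sq_nonneg A, sq_nonneg B]
    rw [hA, hB] at hcp; linarith
  have e : 0 ≤ (A ^ 2 + B ^ 2) * (- ori p c d) := by unfold ori; linarith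
  have := nonneg_of_mul_nonneg_right e hAB
  linarith

theorem ori_as_lin (p u d : Pt) :
    0 < ori p u d ↔ (-(u.2 - p.2)) * p.1 + (u.1 - p.1) * p.2 < (-(u.2 - p.2)) * d.1 + (u.1 - p.1) * d.2 := by
  unfold ori
  constructor <;> intro h <;> linarith


/-- an (oriented) triangular face -/
def Face {S : Finset Pt} (T : PlaneGraph S) (a b c : Pt) : Prop :=
  0 < ori a b c ∧ s(a, b) ∈ T.edges ∧ s(b, c) ∈ T.edges ∧ s(c, a) ∈ T.edges ∧
    ∀ d ∈ S, ¬ (0 < ori a b d ∧ 0 < ori b c d ∧ 0 < ori c a d)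

theorem Face.cyc {S : Finset Pt} {T : PlaneGraph S} {a b c : Pt} (h : Face T a b c) : Face T b c a := by
  obtain ⟨h1, h2, h3, h4, h5⟩ := h
  refine ⟨by rwa [ori_cyc], h3, h4, h2, ?_⟩
  rintro d hd ⟨k1, k2, k3⟩
  exact h5 d hd ⟨k3, k1, k2⟩

theorem on_side (a b c t : Pt) (h : 0 < ori a b c) (h0 : ori a b t = 0) (h1 : 0 ≤ ori b c t)
    (h2 : 0 ≤ ori c a t) : t ∈ segment ℝ a b := by
  obtain ⟨b1, b2, b3⟩ := bary a b c t h.ne'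
  rw [h0] at b1 b2 b3
  have hβ : 0 ≤ ori c a t / ori a b c := by positivity
  have hα : 0 ≤ ori b c t / ori a b c := by positivity
  simp only [zero_div, zero_mul, add_zero] at b1 b2 b3
  exact (mem_seg _ _ _).2 ⟨_, hβ, by linarith, by rw [b1, ← b3]; ring, by rw [b2, ← b3]; ring⟩

theorem inT_pos (a b p x c s : Pt) (h : InT p x c s) (h1 : 0 ≤ ori a b p) (h2 : 0 ≤ ori a b x)
    (h3 : 0 ≤ ori a b c) (h4 : 0 < ori a b p ∨ 0 < ori a b x ∨ 0 < ori a b c) : 0 < ori a b s := by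
  obtain ⟨α, β, γ, hα, hβ, hγ, k1, k2, k3⟩ := h
  rw [ori_comb3 a b p x c s α β γ k1 k2 k3]
  rcases h4 with h4 | h4 | h4 <;> positivity

theorem oseg_pos (a b p d y : Pt) (h : y ∈ openSegment ℝ p d) (h1 : 0 ≤ ori a b p) (h2 : 0 ≤ ori a b d)
    (h4 : 0 < ori a b p ∨ 0 < ori a b d) : 0 < ori a b y := by
  obtain ⟨t, ht0, ht1, k1, k2⟩ := (mem_oseg _ _ _).1 h
  rw [ori_comb a b p d y t k1 k2]
  have : 0 < 1 - t := by linarith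
  rcases h4 with h4 | h4 <;> positivity

theorem seg_zero (a b p d y : Pt) (h : y ∈ segment ℝ p d) (h1 : ori a b p = 0) (h2 : ori a b d = 0) :
    ori a b y = 0 := by
  obtain ⟨t, ht0, ht1, k1, k2⟩ := (mem_seg _ _ _).1 h
  rw [ori_comb a b p d y t k1 k2, h1, h2]; ring

/-- every edge with a point on the left has a face on the left -/
theorem exists_face {S : Finset Pt} (hS : GenPos S) (T : PlaneGraph S) (hT : IsTriangulation T)
    {p q : Pt} (hpq : s(p, q) ∈ T.edges) (hl : ∃ d ∈ S, 0 < ori p q d) : ∃ c, Face T p q c := by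
  have hp := edge_mem_left T hpq
  have hq := edge_mem_right T hpq
  set K := S.filter (fun c => s(p, c) ∈ T.edges ∧ 0 < ori p q c) with hK
  have hKne : K.Nonempty := by
    obtain ⟨d, hd, hd0⟩ := hl
    obtain ⟨c, hc, hcT, hc0⟩ := good_dir hS T hT _ _ hp hd ((ori_as_lin p q d).1 hd0)
    exact ⟨c, by simp only [hK, Finset.mem_filter]; exact ⟨hc, hcT, (ori_as_lin p q c).2 hc0⟩⟩
  obtain ⟨c, hcK, hmin⟩ := ang_min (-(q.2 - p.2)) (q.1 - p.1) p K hKne (by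
    intro c hc
    simp only [hK, Finset.mem_filter] at hc
    exact (ori_as_lin p q c).1 hc.2.2)
  have hcK' := hcK
  simp only [hK, Finset.mem_filter] at hcK'
  obtain ⟨hc, hpc, hΔ⟩ := hcK'
  have noK : ∀ c1 ∈ S, s(p, c1) ∈ T.edges → 0 < ori p q c1 → 0 < ori c p c1 → False := by
    intro c1 h1 h2 h3 h4
    have := hmin c1 (by simp only [hK, Finset.mem_filter]; exact ⟨h1, h2, h3⟩)
    rw [ori_swap] at h4; linarith
  -- emptiness
  have hempty : ∀ d ∈ S, ¬ (0 < ori p q d ∧ 0 < ori q c d ∧ 0 < ori c p d) := by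
    rintro d hd ⟨d1, d2, d3⟩
    have hpd : p ≠ d := by rintro rfl; rw [ori_aba] at d1; exact lt_irrefl _ d1
    by_cases hn : s(p, d) ∈ T.edges
    · exact noK d hd hn d1 d3
    obtain ⟨y, w, z, hwz, hpw, hpz, hy, hyw, ⟨c1, hc1, hT1, h1⟩, ⟨c2, hc2, hT2, h2⟩⟩ :=
      corner_first hS T hT hp hd hpd hn
    have y1 : 0 < ori p q y := oseg_pos _ _ _ _ _ hy (by rw [ori_aba]) d1.le (Or.inr d1)
    have y3 : 0 < ori c p y := oseg_pos _ _ _ _ _ hy (by rw [ori_abb]) d3.le (Or.inr d3)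
    have y2 : 0 < ori q c y := oseg_pos _ _ _ _ _ hy (by rw [ori_cyc]; exact hΔ.le) d2.le (Or.inr d2)
    have main : ∀ w z c1, s(w, z) ∈ T.edges → p ≠ w → p ≠ z → y ∈ segment ℝ w z → c1 ∈ S →
        s(p, c1) ∈ T.edges → (c1 = w ∨ InT p y w c1) → ∃ t ∈ segment ℝ y w, ori q c t = 0 := by
      intro w z c1 hwz hpw hpz hyw hc1 hT1 h1
      have hnot : ¬ (0 < ori p q w ∧ 0 < ori q c w ∧ 0 < ori c p w) := by
        rintro ⟨w1, w2, w3⟩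
        rcases h1 with rfl | h1
        · exact noK _ hc1 hT1 w1 w3
        · exact noK _ hc1 hT1 (inT_pos _ _ _ _ _ _ h1 (by rw [ori_aba]) y1.le w1.le (Or.inr (Or.inl y1)))
            (inT_pos _ _ _ _ _ _ h1 (by rw [ori_abb]) y3.le w3.le (Or.inr (Or.inl y3)))
      obtain ⟨t, ht, t1, t2, t3, t4⟩ := exit3 (ori p q) (ori q c) (ori c p) y w (ori_aff _ _ _ _)
        (ori_aff _ _ _ _) (ori_aff _ _ _ _) y1 y2 y3 hnot
      have htwz : t ∈ segment ℝ w z := seg_sub hyw (left_mem_segment ℝ _ _) ht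
      have hpt : t ≠ p := by
        rintro rfl
        rcases pt_on_seg hS (edge_mem_left T hwz) (edge_mem_right T hwz) hp (edge_ne T hwz) htwz with h | h
        · exact hpw h
        · exact hpz h
      refine ⟨t, ht, ?_⟩
      rcases t4 with t4 | t4 | t4
      · have := on_side p q c t hΔ t4 t2 t3
        rcases noncross T hpq hwz this htwz with h | ⟨h, -⟩
        · rcases Sym2.eq_iff.1 h with ⟨h, -⟩ | ⟨h, -⟩
          · exact absurd h hpw
          · exact absurd h hpz
        · rcases h with h | h
          · exact absurd h hpt
          · rw [h, ori_aba]
      · exact t4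
      · have := on_side c p q t (by rwa [ori_cyc2]) t4 t1 t2
        rcases noncross T (edge_symm T hpc) hwz this htwz with h | ⟨h, -⟩
        · rcases Sym2.eq_iff.1 h with ⟨-, h⟩ | ⟨-, h⟩
          · exact absurd h hpz
          · exact absurd h hpw
        · rcases h with h | h
          · rw [h, ori_abb]
          · exact absurd h hpt
    obtain ⟨t, ht, ht0⟩ := main w z c1 hwz hpw hpz hyw hc1 hT1 h1
    obtain ⟨t', ht', ht0'⟩ := main z w c2 (edge_symm T hwz) hpz hpw (by rwa [segment_symm]) hc2 hT2 h2
    -- y lies between w and z, hence the functional vanishes at y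
    obtain ⟨a, ha0, ha1, ha2, ha3⟩ := (mem_seg _ _ _).1 ht
    obtain ⟨b, hb0, hb1, hb2, hb3⟩ := (mem_seg _ _ _).1 ht'
    obtain ⟨r, hr0, hr1, hr2, hr3⟩ := (mem_seg _ _ _).1 hyw
    have e1 := ori_comb q c y w t a ha2 ha3
    have e2 := ori_comb q c y z t' b hb2 hb3
    have e3 := ori_comb q c w z y r hr2 hr3
    rw [ht0] at e1
    rw [ht0'] at e2
    have w0 : ori q c w < 0 := by
      by_contra hcon
      rcases eq_or_lt_of_le ha1 with h | h
      · rw [h] at e1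
        have hz0 : ori q c w = 0 := by linarith
        rw [hz0] at e3
        have hz1 : ori q c z ≤ 0 := by
          by_contra hz
          push Not at hz
          rcases eq_or_lt_of_le hb1 with h' | h'
          · rw [h'] at e2; linarith
          · have : 0 < (1 - b) * ori q c y := mul_pos (by linarith) y2
            have : 0 ≤ b * ori q c z := by positivity
            linarith
        nlinarith
      · have : 0 < (1 - a) * ori q c y := mul_pos (by linarith) y2
        have : 0 ≤ a * ori q c w := mul_nonneg ha0 (by linarith)
        linarith
    have z0 : ori q c z ≤ 0 := by
      by_contra hz
      push Not at hz
      rcases eq_or_lt_of_le hb1 with h' | h'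
      · rw [h'] at e2; linarith
      · have : 0 < (1 - b) * ori q c y := mul_pos (by linarith) y2
        have : 0 ≤ b * ori q c z := by positivity
        linarith
    nlinarith
  have hqc : q ≠ c := by rintro rfl; rw [ori_abb] at hΔ; exact lt_irrefl _ hΔ
  have hyp : CornerHyp T q p c := by
    rintro u v huv hne ⟨y, hy, hyuv⟩ ζ hζ
    have offu := cross_off hS hq hc (edge_mem_left T huv) (edge_mem_right T huv) hqc hne (edge_ne T huv) hy hyuv
    have offv := cross_off' hS hq hc (edge_mem_left T huv) (edge_mem_right T huv) hqc hne (edge_ne T huv) hy hyuv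
    have y1 : 0 < ori p q y := oseg_pos _ _ _ _ _ hy (by rw [ori_abb]) hΔ.le (Or.inr hΔ)
    have y3 : 0 < ori c p y := oseg_pos _ _ _ _ _ hy (by rw [ori_cyc2]; exact hΔ.le) (by rw [ori_aba])
      (Or.inl (by rwa [ori_cyc2]))
    have fromp : ∀ v, s(p, v) ∈ T.edges → y ∈ segment ℝ p v → False := by
      intro v hpv hyv
      obtain ⟨t, ht0, ht1, k1, k2⟩ := (mem_seg _ _ _).1 hyv
      have e1 := ori_comb p q p v y t k1 k2
      have e2 := ori_comb c p p v y t k1 k2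
      rw [ori_aba] at e1
      rw [ori_abb] at e2
      apply noK v (edge_mem_right T hpv) hpv
      · by_contra hcon; push Not at hcon; nlinarith
      · by_contra hcon; push Not at hcon; nlinarith
    have endp : ζ ≠ q ∧ ζ ≠ c ∧ ζ ≠ p := by
      refine ⟨?_, ?_, ?_⟩
      · rintro rfl
        rcases pt_on_seg hS (edge_mem_left T huv) (edge_mem_right T huv) hq (edge_ne T huv) hζ with rfl | rfl
        · exact offu (ori_aba _ _)
        · exact offv (ori_aba _ _)
      · rintro rfl
        rcases pt_on_seg hS (edge_mem_left T huv) (edge_mem_right T huv) hc (edge_ne T huv) hζ with rfl | rfl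
        · exact offu (ori_abb _ _)
        · exact offv (ori_abb _ _)
      · rintro rfl
        rcases pt_on_seg hS (edge_mem_left T huv) (edge_mem_right T huv) hp (edge_ne T huv) hζ with rfl | rfl
        · exact fromp v huv hyuv
        · exact fromp u (edge_symm T huv) (by rwa [segment_symm])
    obtain ⟨n1, n2, n3⟩ := endp
    constructor
    · intro h
      rw [segment_symm] at h
      rcases noncross T hpq huv h hζ with h | ⟨h, -⟩
      · have : y ∈ segment ℝ p q := by rw [← seg2_mk, h]; exact hyuv
        have := seg_ori _ _ _ this
        linarith
      · rcases h with h | h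
        · exact n3 h
        · exact n1 h
    · intro h
      rcases noncross T hpc huv h hζ with h | ⟨h, -⟩
      · have : y ∈ segment ℝ p c := by rw [← seg2_mk, h]; exact hyuv
        have := seg_ori _ _ _ this
        rw [ori_swap] at y3
        linarith
      · rcases h with h | h
        · exact n3 h
        · exact n2 h
  obtain ⟨c', hc', hcT, h⟩ := corner hS T hT hq _ p c hc (by rw [ori_swap]; linarith) le_rfl hyp
  have : c' = c := by
    rcases h with h | h
    · exact h
    · exfalso
      apply hempty c' hc'
      refine ⟨inT_pos _ _ _ _ _ _ h (by rw [ori_abb]) (by rw [ori_aba]) hΔ.le (Or.inr (Or.inr hΔ)),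
        inT_pos _ _ _ _ _ _ h (by rw [ori_aba]) (by rw [ori_cyc]; exact hΔ.le) (by rw [ori_abb])
          (Or.inr (Or.inl (by rwa [ori_cyc]))),
        inT_pos _ _ _ _ _ _ h (by rw [ori_cyc2]; exact hΔ.le) (by rw [ori_abb]) (by rw [ori_aba])
          (Or.inl (by rwa [ori_cyc2]))⟩
  subst this
  exact ⟨c', hΔ, hpq, hcT, edge_symm T hpc, hempty⟩

/-- edges do not meet the interior of a face -/
theorem face_interior {S : Finset Pt} (T : PlaneGraph S)
    {p q c u v y : Pt} (hF : Face T p q c) (huv : s(u, v) ∈ T.edges) (hy : y ∈ segment ℝ u v) :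
    ¬ (0 < ori p q y ∧ 0 < ori q c y ∧ 0 < ori c p y) := by
  rintro ⟨y1, y2, y3⟩
  obtain ⟨hΔ, hpq, hqc, hcp, hemp⟩ := hF
  have main : ∀ u v, s(u, v) ∈ T.edges → y ∈ segment ℝ u v → u = p ∨ u = q ∨ u = c := by
    intro u v huv hy
    obtain ⟨t, ht, t1, t2, t3, t4⟩ := exit3 (ori p q) (ori q c) (ori c p) y u (ori_aff _ _ _ _)
        (ori_aff _ _ _ _) (ori_aff _ _ _ _) y1 y2 y3 (hemp u (edge_mem_left T huv))
    have htuv : t ∈ segment ℝ u v := seg_sub hy (left_mem_segment ℝ _ _) ht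
    have key : (t = p ∨ t = q ∨ t = c) ∧ (t = u ∨ t = v) := by
      rcases t4 with t4 | t4 | t4
      · have := on_side p q c t hΔ t4 t2 t3
        rcases noncross T hpq huv this htuv with h | ⟨h, h'⟩
        · have : y ∈ segment ℝ p q := by rw [← seg2_mk, h]; exact hy
          have := seg_ori _ _ _ this
          linarith
        · exact ⟨by tauto, h'⟩
      · have := on_side q c p t (by rwa [ori_cyc]) t4 t3 t1
        rcases noncross T hqc huv this htuv with h | ⟨h, h'⟩
        · have : y ∈ segment ℝ q c := by rw [← seg2_mk, h]; exact hy
          have := seg_ori _ _ _ this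
          linarith
        · exact ⟨by tauto, h'⟩
      · have := on_side c p q t (by rwa [ori_cyc2]) t4 t1 t2
        rcases noncross T hcp huv this htuv with h | ⟨h, h'⟩
        · have : y ∈ segment ℝ c p := by rw [← seg2_mk, h]; exact hy
          have := seg_ori _ _ _ this
          linarith
        · exact ⟨by tauto, h'⟩
    obtain ⟨k1, k2⟩ := key
    rcases k2 with rfl | rfl
    · exact k1
    · -- t = v lies on [y,u], so y = v
      exfalso
      obtain ⟨a, ha0, ha1, ha2, ha3⟩ := (mem_seg _ _ _).1 hy
      obtain ⟨b, hb0, hb1, hb2, hb3⟩ := (mem_seg _ _ _).1 ht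
      have hne := edge_ne T huv
      have e : (1 - b) * a = 1 := by
        by_contra hcon
        have hk : 1 - (1 - b) * a ≠ 0 := fun h => hcon (by linarith)
        apply hne
        apply Prod.ext
        · have : (1 - (1 - b) * a) * (t.1 - u.1) = 0 := by rw [ha2] at hb2; linear_combination hb2
          rcases mul_eq_zero.1 this with h | h
          · exact absurd h hk
          · linarith
        · have : (1 - (1 - b) * a) * (t.2 - u.2) = 0 := by rw [ha3] at hb3; linear_combination hb3
          rcases mul_eq_zero.1 this with h | h
          · exact absurd h hk
          · linarith
      have ha : a = 1 := by nlinarith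
      have : y = t := by
        apply Prod.ext
        · rw [ha2, ha]; ring
        · rw [ha3, ha]; ring
      subst this
      exact hemp y (edge_mem_right T huv) ⟨y1, y2, y3⟩
  have hu := main u v huv hy
  have hv := main v u (edge_symm T huv) (by rwa [segment_symm])
  have hne := edge_ne T huv
  have z1 := seg_zero p q u v y hy
  have z2 := seg_zero q c u v y hy
  have z3 := seg_zero c p u v y hy
  rcases hu with rfl | rfl | rfl <;> rcases hv with rfl | rfl | rfl <;>
    simp_all [ori_aba, ori_abb]

/-- an edge at `p` is not strictly inside the corner of a face at `p` -/
theorem face_corner {S : Finset Pt} (T : PlaneGraph S)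
    {p q c b : Pt} (hF : Face T p q c) (hb : s(p, b) ∈ T.edges) (h1 : 0 < ori p q b) :
    0 ≤ ori p c b := by
  by_contra h2
  push Not at h2
  have hΔ := hF.1
  -- choose a small parameter
  obtain ⟨ε, he0, he1, he2⟩ : ∃ ε : ℝ, 0 < ε ∧ ε ≤ 1 ∧ 0 < (1 - ε) * ori p q c + ε * ori q c b := by
    refine ⟨ori p q c / (ori p q c + |ori q c b| + ori p q c), by positivity, ?_, ?_⟩
    · rw [div_le_one (by positivity)]; have := abs_nonneg (ori q c b); linarith
    · have hpos : 0 < ori p q c + |ori q c b| + ori p q c := by positivity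
      have : (1 - ori p q c / (ori p q c + |ori q c b| + ori p q c)) * ori p q c +
        ori p q c / (ori p q c + |ori q c b| + ori p q c) * ori q c b =
        ori p q c * (ori p q c + (|ori q c b| + ori q c b)) / (ori p q c + |ori q c b| + ori p q c) := by
        field_simp; ring
      rw [this]
      have := neg_abs_le (ori q c b)
      apply div_pos _ hpos
      apply mul_pos hΔ
      linarith
  apply face_interior T hF hb (y := ((1 - ε) * p.1 + ε * b.1, (1 - ε) * p.2 + ε * b.2))
    ((mem_seg _ _ _).2 ⟨ε, he0.le, he1, rfl, rfl⟩)
  rw [ori_aff, ori_aff, ori_aff, ori_aba, ori_abb, ori_cyc p q c, ori_swap p c b]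
  refine ⟨by nlinarith, he2, by nlinarith⟩

theorem face_unique {S : Finset Pt} (hS : GenPos S) (T : PlaneGraph S)
    {p q c c' : Pt} (h : Face T p q c) (h' : Face T p q c') : c = c' := by
  have h1 := face_corner T h (edge_symm T h'.2.2.2.1) h'.1
  have h2 := face_corner T h' (edge_symm T h.2.2.2.1) h.1
  have h3 : ori p c c' = 0 := by rw [ori_swap2] at h2; linarith
  have hc := edge_symm T h.2.2.2.1
  have hc' := edge_symm T h'.2.2.2.1
  rcases genpos_eq hS (edge_mem_left T hc) (edge_mem_right T hc) (edge_mem_right T hc') (edge_ne T hc) h3 with e | e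
  · exact absurd e.symm (edge_ne T hc')
  · exact e.symm



/-- a linear functional -/
def fn (t : ℝ) (s : Pt) : ℝ := 1 * s.1 + t * s.2

theorem exists_generic (S : Finset Pt) : ∃ t : ℝ, ∀ p ∈ S, ∀ q ∈ S, fn t p = fn t q → p = q := by
  obtain ⟨t, ht⟩ := Infinite.exists_notMem_finset
    ((S ×ˢ S).image (fun x => -(x.1.1 - x.2.1) / (x.1.2 - x.2.2)))
  refine ⟨t, fun p hp q hq h => ?_⟩
  unfold fn at h
  by_cases h2 : p.2 = q.2
  · exact Prod.ext (by rw [h2] at h; linarith) h2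
  · exfalso
    apply ht
    rw [Finset.mem_image]
    refine ⟨(p, q), Finset.mk_mem_product hp hq, ?_⟩
    have : p.2 - q.2 ≠ 0 := sub_ne_zero.2 h2
    simp only
    field_simp
    linarith

def InA (S : Finset Pt) (t : ℝ) (p : Pt) : Prop :=
  ∃ l ∈ S, ∃ r ∈ S, fn t l < fn t p ∧ fn t p < fn t r ∧ 0 < ori l p r

def InB (S : Finset Pt) (t : ℝ) (p : Pt) : Prop :=
  ∃ l ∈ S, ∃ r ∈ S, fn t l < fn t p ∧ fn t p < fn t r ∧ ori l p r < 0

theorem fn_ident (t : ℝ) (p a b c : Pt) :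
    (fn t a - fn t p) * ori p b c + (fn t b - fn t p) * ori p c a + (fn t c - fn t p) * ori p a b = 0 := by
  unfold fn ori; ring

theorem edge0 {S : Finset Pt} (hS : GenPos S) (T : PlaneGraph S) (hT : IsTriangulation T) (t : ℝ)
    {p : Pt} (hp : p ∈ S) (h : ∃ q ∈ S, fn t p < fn t q) :
    ∃ w, s(p, w) ∈ T.edges ∧ fn t p < fn t w ∧
      ∀ d, s(p, d) ∈ T.edges → fn t p < fn t d → 0 ≤ ori p w d := by
  obtain ⟨q, hq, hpq⟩ := h
  obtain ⟨c, hc, hpc, hcl⟩ := good_dir hS T hT 1 t hp hq hpq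
  obtain ⟨w, hw, hm⟩ := ang_min 1 t p (S.filter (fun c => s(p, c) ∈ T.edges ∧ fn t p < fn t c))
    ⟨c, by rw [Finset.mem_filter]; exact ⟨hc, hpc, hcl⟩⟩ (fun c hc => (Finset.mem_filter.1 hc).2.2)
  have hw' := (Finset.mem_filter.1 hw).2
  refine ⟨w, hw'.1, hw'.2, fun d hd hfd => hm d ?_⟩
  rw [Finset.mem_filter]; exact ⟨edge_mem_right T hd, hd, hfd⟩

theorem edgeA {S : Finset Pt} (hS : GenPos S) (T : PlaneGraph S) (hT : IsTriangulation T) (t : ℝ)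
    (hi : ∀ p ∈ S, ∀ q ∈ S, fn t p = fn t q → p = q)
    {p : Pt} (hp : p ∈ S) (h : InA S t p) :
    ∃ l w, fn t l < fn t p ∧ fn t p < fn t w ∧ Face T w l p := by
  obtain ⟨l0, hl0, r0, hr0, h1, h2, h3⟩ := h
  obtain ⟨c, hc, hpc, hcl⟩ := good_dir hS T hT 1 t hp hr0 h2
  obtain ⟨w, hw, hm⟩ := ang_max 1 t p (S.filter (fun c => s(p, c) ∈ T.edges ∧ fn t p < fn t c))
    ⟨c, by rw [Finset.mem_filter]; exact ⟨hc, hpc, hcl⟩⟩ (fun c hc => (Finset.mem_filter.1 hc).2.2)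
  have hw' := (Finset.mem_filter.1 hw).2
  have hex : ∃ d ∈ S, 0 < ori p w d := by
    by_contra hcon
    push Not at hcon
    have k1 := hcon r0 hr0
    have k2 := hcon l0 hl0
    have id := fn_ident t p w r0 l0
    rw [ori_cyc l0 p r0] at id
    rw [ori_swap2 p w l0] at id
    have := hw'.2
    have z1 : 0 < (fn t w - fn t p) * ori l0 p r0 := mul_pos (by linarith) h3
    have z2 : (fn t r0 - fn t p) * ori p w l0 ≤ 0 := mul_nonpos_of_nonneg_of_nonpos (by linarith) k2
    have z3 : 0 ≤ (fn t l0 - fn t p) * ori p w r0 := mul_nonneg_of_nonpos_of_nonpos (by linarith) k1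
    linarith
  obtain ⟨x, hx⟩ := exists_face hS T hT hw'.1 hex
  refine ⟨x, w, ?_, hw'.2, hx.cyc⟩
  have hxp := edge_symm T hx.2.2.2.1
  by_contra hcon
  push Not at hcon
  rcases hcon.lt_or_eq with h | h
  · have := hm x (by rw [Finset.mem_filter]; exact ⟨edge_mem_right T hxp, hxp, h⟩)
    linarith [hx.1]
  · exact edge_ne T hxp (hi p hp x (edge_mem_right T hxp) h)

theorem edgeB {S : Finset Pt} (hS : GenPos S) (T : PlaneGraph S) (hT : IsTriangulation T) (t : ℝ)
    (hi : ∀ p ∈ S, ∀ q ∈ S, fn t p = fn t q → p = q)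
    {p : Pt} (hp : p ∈ S) (h : InB S t p) :
    ∃ l w, fn t l < fn t p ∧ fn t p < fn t w ∧ Face T p l w := by
  obtain ⟨l0, hl0, r0, hr0, h1, h2, h3⟩ := h
  obtain ⟨c, hc, hpc, hcl⟩ := good_dir hS T hT 1 t hp hr0 h2
  obtain ⟨w, hw, hm⟩ := ang_min 1 t p (S.filter (fun c => s(p, c) ∈ T.edges ∧ fn t p < fn t c))
    ⟨c, by rw [Finset.mem_filter]; exact ⟨hc, hpc, hcl⟩⟩ (fun c hc => (Finset.mem_filter.1 hc).2.2)
  have hw' := (Finset.mem_filter.1 hw).2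
  have hex : ∃ d ∈ S, 0 < ori w p d := by
    by_contra hcon
    push Not at hcon
    have k1 := hcon r0 hr0
    have k2 := hcon l0 hl0
    have id := fn_ident t p w r0 l0
    rw [ori_cyc l0 p r0] at id
    rw [ori_swap2 p w l0] at id
    rw [ori_swap] at k1 k2
    have := hw'.2
    have z1 : 0 < (fn t w - fn t p) * (- ori l0 p r0) := mul_pos (by linarith) (by linarith)
    have z2 : 0 ≤ (fn t r0 - fn t p) * ori p w l0 := mul_nonneg (by linarith) (by linarith)
    have z3 : (fn t l0 - fn t p) * ori p w r0 ≤ 0 := mul_nonpos_of_nonpos_of_nonneg (by linarith) (by linarith)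
    linarith
  obtain ⟨x, hx⟩ := exists_face hS T hT (edge_symm T hw'.1) hex
  refine ⟨x, w, ?_, hw'.2, hx.cyc⟩
  have hxp := hx.2.2.1
  by_contra hcon
  push Not at hcon
  rcases hcon.lt_or_eq with h | h
  · have := hm x (by rw [Finset.mem_filter]; exact ⟨edge_mem_right T hxp, hxp, h⟩)
    have := hx.1
    rw [ori_swap] at this
    linarith
  · exact edge_ne T hxp (hi p hp x (edge_mem_right T hxp) h)

theorem sym_ord (t : ℝ) {l w l' w' : Pt} (h1 : fn t l < fn t w) (h2 : fn t l' < fn t w')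
    (h : s(l, w) = s(l', w')) : l = l' ∧ w = w' := by
  rw [Sym2.eq_iff] at h
  rcases h with h | ⟨rfl, rfl⟩
  · exact h
  · linarith

theorem edge_count {S : Finset Pt} (hS : GenPos S) (T : PlaneGraph S) (hT : IsTriangulation T) (t : ℝ)
    (hi : ∀ p ∈ S, ∀ q ∈ S, fn t p = fn t q → p = q) (hne : S.Nonempty) :
    S.card + (S.filter (InA S t)).card + (S.filter (InB S t)).card ≤ T.edges.card + 1 := by
  obtain ⟨m, hm, hmax⟩ := S.exists_max_image (fn t) hne
  have h0 : ∀ p, p ∈ S.erase m → ∃ w, s(p, w) ∈ T.edges ∧ fn t p < fn t w ∧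
      ∀ d, s(p, d) ∈ T.edges → fn t p < fn t d → 0 ≤ ori p w d := by
    intro p hp
    have hpS := Finset.mem_of_mem_erase hp
    refine edge0 hS T hT t hpS ⟨m, hm, lt_of_le_of_ne (hmax p hpS) ?_⟩
    intro h
    exact Finset.ne_of_mem_erase hp (hi p hpS m hm h)
  have hA : ∀ p, p ∈ S.filter (InA S t) → ∃ l w, fn t l < fn t p ∧ fn t p < fn t w ∧ Face T w l p :=
    fun p hp => edgeA hS T hT t hi (Finset.mem_filter.1 hp).1 (Finset.mem_filter.1 hp).2
  have hB : ∀ p, p ∈ S.filter (InB S t) → ∃ l w, fn t l < fn t p ∧ fn t p < fn t w ∧ Face T p l w :=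
    fun p hp => edgeB hS T hT t hi (Finset.mem_filter.1 hp).1 (Finset.mem_filter.1 hp).2
  choose! w0 h01 h02 h03 using h0
  choose! lA wA hA1 hA2 hA3 using hA
  choose! lB wB hB1 hB2 hB3 using hB
  have c0 : ((S.erase m).image (fun p => s(p, w0 p))).card = (S.erase m).card := by
    apply Finset.card_image_of_injOn
    intro p hp q hq h
    exact (sym_ord t (h02 p hp) (h02 q hq) h).1
  have cA : ((S.filter (InA S t)).image (fun p => s(lA p, wA p))).card = (S.filter (InA S t)).card := by
    apply Finset.card_image_of_injOn
    intro p hp q hq h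
    obtain ⟨e1, e2⟩ := sym_ord t ((hA1 p hp).trans (hA2 p hp)) ((hA1 q hq).trans (hA2 q hq)) h
    have k1 := hA3 p hp
    have k2 := hA3 q hq
    rw [e1, e2] at k1
    exact face_unique hS T k1 k2
  have cB : ((S.filter (InB S t)).image (fun p => s(lB p, p))).card = (S.filter (InB S t)).card := by
    apply Finset.card_image_of_injOn
    intro p hp q hq h
    exact (sym_ord t (hB1 p hp) (hB1 q hq) h).2
  have d1 : Disjoint ((S.erase m).image (fun p => s(p, w0 p)))
      ((S.filter (InA S t)).image (fun p => s(lA p, wA p))) := by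
    rw [Finset.disjoint_left]
    intro e he he'
    obtain ⟨p, hp, rfl⟩ := Finset.mem_image.1 he
    obtain ⟨q, hq, h⟩ := Finset.mem_image.1 he'
    obtain ⟨e1, e2⟩ := sym_ord t ((hA1 q hq).trans (hA2 q hq)) (h02 p hp) h
    have k := hA3 q hq
    have k1 := hA1 q hq
    rw [e1] at k k1
    rw [e2] at k
    have := h03 p hp q k.2.2.1 k1
    have h4 := k.1
    rw [ori_swap] at h4
    linarith
  have d2 : Disjoint ((S.erase m).image (fun p => s(p, w0 p)))
      ((S.filter (InB S t)).image (fun p => s(lB p, p))) := by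
    rw [Finset.disjoint_left]
    intro e he he'
    obtain ⟨p, hp, rfl⟩ := Finset.mem_image.1 he
    obtain ⟨q, hq, h⟩ := Finset.mem_image.1 he'
    obtain ⟨e1, e2⟩ := sym_ord t (hB1 q hq) (h02 p hp) h
    have k := hB3 q hq
    have k1 := (hB1 q hq).trans (hB2 q hq)
    rw [e1] at k k1
    have := h03 p hp (wB q) k.2.2.1 k1
    have h4 := k.1
    rw [ori_swap] at h4
    rw [← e2] at this
    linarith
  have d3 : Disjoint ((S.filter (InA S t)).image (fun p => s(lA p, wA p)))
      ((S.filter (InB S t)).image (fun p => s(lB p, p))) := by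
    rw [Finset.disjoint_left]
    intro e he he'
    obtain ⟨p, hp, rfl⟩ := Finset.mem_image.1 he
    obtain ⟨q, hq, h⟩ := Finset.mem_image.1 he'
    obtain ⟨e1, e2⟩ := sym_ord t (hB1 q hq) ((hA1 p hp).trans (hA2 p hp)) h
    have k1 := hB3 q hq
    have k2 := hA3 p hp
    rw [← e1, ← e2] at k2
    have := face_unique hS T k1 k2
    have z1 := hA2 p hp
    have z2 := hB2 q hq
    rw [this] at z2
    rw [← e2] at z1
    linarith
  have hsub : ((S.erase m).image (fun p => s(p, w0 p)) ∪
      (S.filter (InA S t)).image (fun p => s(lA p, wA p))) ∪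
      (S.filter (InB S t)).image (fun p => s(lB p, p)) ⊆ T.edges := by
    intro e he
    simp only [Finset.mem_union, Finset.mem_image] at he
    rcases he with (⟨p, hp, rfl⟩ | ⟨p, hp, rfl⟩) | ⟨p, hp, rfl⟩
    · exact h01 p hp
    · exact edge_symm T (hA3 p hp).2.1
    · exact edge_symm T (hB3 p hp).2.1
  have := Finset.card_le_card hsub
  rw [Finset.card_union_of_disjoint (Finset.disjoint_union_left.2 ⟨d2, d3⟩),
    Finset.card_union_of_disjoint d1, c0, cA, cB, Finset.card_erase_of_mem hm] at this
  have := Finset.card_pos.2 hne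
  omega


def WedgeGood {S : Finset Pt} (D : PlaneGraph S) : Prop :=
  ∀ p ∈ S, ∀ q ∈ S, p ≠ q → s(p, q) ∈ D.edges ∨
    ∃ a b, s(p, a) ∈ D.edges ∧ s(p, b) ∈ D.edges ∧ 0 < ori p a q ∧ 0 < ori p q b ∧ 0 < ori p a b

theorem WedgeGood.mono {S : Finset Pt} {D D' : PlaneGraph S} (h : WedgeGood D)
    (hs : D.edges ⊆ D'.edges) : WedgeGood D' := by
  intro p hp q hq hpq
  rcases h p hp q hq hpq with h | ⟨a, b, h1, h2, h3⟩
  · exact Or.inl (hs h)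
  · exact Or.inr ⟨a, b, hs h1, hs h2, h3⟩

theorem plucker (p a b c d : Pt) :
    ori p a b * ori p c d - ori p a c * ori p b d + ori p a d * ori p b c = 0 := by
  unfold ori; ring

theorem pos_of_mul_pos' {x y : ℝ} (h : 0 < x * y) (hy : 0 < y) : 0 < x := by
  by_contra hx
  push Not at hx
  nlinarith

theorem convex_at {S : Finset Pt} (T : PlaneGraph S) {p q a b c d : Pt} (h1 : Face T p q c)
    (h2 : Face T q p d) (ha : s(p, a) ∈ T.edges) (hb : s(p, b) ∈ T.edges)
    (haq : 0 < ori p a q) (hqb : 0 < ori p q b) (hab : 0 < ori p a b) : 0 < ori p d c := by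
  have k1 : 0 ≤ ori p c b := face_corner T h1 hb hqb
  have h3 := h2.cyc
  have k2 : 0 ≤ ori p a d := by
    by_contra hcon
    have := face_corner T h3 ha (by rw [ori_swap2]; linarith)
    rw [ori_swap2] at this
    linarith
  have k3 := h1.1
  have k4 := h3.1
  have k5 : 0 < ori p a c := by
    apply pos_of_mul_pos' _ hqb
    have := plucker p a q c b
    have e : ori p a c * ori p q b = ori p a q * ori p c b + ori p a b * ori p q c := by linarith
    rw [e]; positivity
  have := plucker p a q d c
  have e : ori p d c * ori p a q = ori p a d * ori p q c + ori p a c * ori p d q := by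
    rw [ori_swap2 p q d]; linarith [ori_swap2 p q d, plucker p a q d c, mul_comm (ori p d c) (ori p a q),
      show ori p a c * ori p q d = - (ori p a c * ori p d q) by rw [ori_swap2 p d q]; ring,
      show ori p a c * -ori p q d = (ori p a c * ori p d q) by rw [ori_swap2 p d q]; ring]
  apply pos_of_mul_pos' _ haq
  rw [e]; positivity

def subG {S : Finset Pt} (T : PlaneGraph S) (E : Finset (Sym2 Pt)) (h : E ⊆ T.edges) : PlaneGraph S where
  edges := E
  endpoint_mem := fun e he => T.endpoint_mem e (h he)
  not_isDiag := fun e he => T.not_isDiag e (h he)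
  noncrossing := fun e he e' he' => T.noncrossing e (h he) e' (h he')

theorem flip_aux (p q c d y : Pt) (h2 : 0 < ori p d c)
    (h3 : 0 < ori q c d) (hy : y ∈ openSegment ℝ c d) :
    (0 < ori q c y ∧ 0 < ori c p y) ∧ (0 < ori p d y ∧ 0 < ori d q y) := by
  refine ⟨⟨?_, ?_⟩, ?_, ?_⟩
  · exact oseg_pos _ _ _ _ _ hy (by rw [ori_abb]) h3.le (Or.inr h3)
  · exact oseg_pos _ _ _ _ _ hy (by rw [ori_aba]) (by rw [ori_cyc2]; exact h2.le)
      (Or.inr (by rw [ori_cyc2]; exact h2))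
  · exact oseg_pos _ _ _ _ _ hy h2.le (by rw [ori_abb]) (Or.inl h2)
  · exact oseg_pos _ _ _ _ _ hy (by rw [ori_cyc2]; exact h3.le) (by rw [ori_aba])
      (Or.inl (by rw [ori_cyc2]; exact h3))

theorem flip_pair {S : Finset Pt} (hS : GenPos S) (T : PlaneGraph S) (hT : IsTriangulation T)
    (D : PlaneGraph S) (hD : WedgeGood D) (hDT : D.edges ⊆ T.edges) {p q : Pt}
    (hpq : s(p, q) ∈ T.edges) (hpqD : s(p, q) ∉ D.edges) :
    ∃ D1 D2 : PlaneGraph S, D.edges ⊆ D1.edges ∧ D.edges ⊆ D2.edges ∧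
      D1.edges.card = D.edges.card + 1 ∧ D2.edges.card ≤ D.edges.card + 1 ∧
      ∀ G : PlaneGraph S, D1.edges ⊆ G.edges → D2.edges ⊆ G.edges → False := by
  have hp := edge_mem_left T hpq
  have hq := edge_mem_right T hpq
  have hne := edge_ne T hpq
  obtain ⟨a1, b1, ha1, hb1, ha1q, hqb1, hab1⟩ := (hD p hp q hq hne).resolve_left hpqD
  obtain ⟨a2, b2, ha2, hb2, ha2q, hqb2, hab2⟩ := (hD q hq p hp hne.symm).resolve_left
    (by rwa [Sym2.eq_swap])
  obtain ⟨c, hc⟩ := exists_face hS T hT hpq ⟨b1, edge_mem_right D hb1, hqb1⟩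
  obtain ⟨d, hd⟩ := exists_face hS T hT (edge_symm T hpq) ⟨b2, edge_mem_right D hb2, hqb2⟩
  have v1 := convex_at T hc hd (hDT ha1) (hDT hb1) ha1q hqb1 hab1
  have v2 := convex_at T hd hc (hDT ha2) (hDT hb2) ha2q hqb2 hab2
  have aux := fun y hy => flip_aux p q c d y v1 v2 hy
  have hcS := edge_mem_right T hc.2.2.1
  have hdS := edge_mem_right T hd.2.2.1
  have hcd : c ≠ d := by
    rintro rfl
    rw [ori_abb] at v1
    exact lt_irrefl _ v1
  have hplane : ∀ u v, s(u, v) ∈ D.edges → s(u, v) ≠ s(c, d) →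
      ∀ x ∈ openSegment ℝ c d, x ∉ segment ℝ u v := by
    intro u v huv _ y hy hyu
    obtain ⟨⟨y1, y2⟩, y3, y4⟩ := aux y hy
    rcases lt_trichotomy (ori p q y) 0 with h | h | h
    · refine face_interior T hd (hDT huv) hyu ⟨by rw [ori_swap]; linarith, y3, y4⟩
    · have := on_side p q c y hc.1 h y1.le y2.le
      rcases noncross T hpq (hDT huv) this hyu with h | ⟨h | h, _⟩
      · exact hpqD (h ▸ huv)
      · rw [h, ori_abb] at y2; exact lt_irrefl _ y2
      · rw [h, ori_aba] at y1; exact lt_irrefl _ y1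
    · exact face_interior T hc (hDT huv) hyu ⟨h, y1, y2⟩
  refine ⟨subG T (insert s(p, q) D.edges) (Finset.insert_subset hpq hDT),
    addEdge hS D c d hcS hdS hcd hplane, Finset.subset_insert _ _, Finset.subset_insert _ _,
    Finset.card_insert_of_notMem hpqD, Finset.card_insert_le _ _, ?_⟩
  intro G h1 h2
  have g1 : s(p, q) ∈ G.edges := h1 (Finset.mem_insert_self _ _)
  have g2 : s(c, d) ∈ G.edges := h2 (Finset.mem_insert_self _ _)
  have k1 := hc.1
  have k2 := hd.1
  rw [ori_swap] at k2
  have hden : 0 < ori p q c - ori p q d := by linarith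
  obtain ⟨X, hX, hX0⟩ : ∃ X ∈ openSegment ℝ c d, ori p q X = 0 := by
    set t := ori p q c / (ori p q c - ori p q d) with ht
    refine ⟨((1 - t) * c.1 + t * d.1, (1 - t) * c.2 + t * d.2), (mem_oseg _ _ _).2
      ⟨t, by positivity, by rw [ht, div_lt_one hden]; linarith, rfl, rfl⟩, ?_⟩
    rw [ori_aff, ht]
    field_simp
    ring
  obtain ⟨⟨y1, y2⟩, y3, y4⟩ := aux X hX
  have := on_side p q c X hc.1 hX0 y1.le y2.le
  rcases noncross G g1 g2 this (oseg_sub _ _ _ hX) with h | ⟨h | h, _⟩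
  · have hcm : c ∈ s(p, q) := by rw [h]; simp
    rw [Sym2.mem_iff] at hcm
    rcases hcm with rfl | rfl
    · rw [ori_aba] at k1; exact lt_irrefl _ k1
    · rw [ori_abb] at k1; exact lt_irrefl _ k1
  · rw [h, ori_abb] at y2; exact lt_irrefl _ y2
  · rw [h, ori_aba] at y1; exact lt_irrefl _ y1

theorem PlaneGraph.ext' {S : Finset Pt} {G H : PlaneGraph S} (h : G.edges = H.edges) : G = H := by
  cases G; cases H; simp only at h; subst h; rfl

theorem edges_sub {S : Finset Pt} (G : PlaneGraph S) : G.edges ⊆ S.sym2 := by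
  intro e he
  rw [Finset.mem_sym2_iff]
  exact G.endpoint_mem e he

theorem finPG (S : Finset Pt) : Finite (PlaneGraph S) := by
  apply Finite.of_injective (β := {E // E ∈ S.sym2.powerset})
    (fun G => ⟨G.edges, Finset.mem_powerset.2 (edges_sub G)⟩)
  intro G H h
  exact PlaneGraph.ext' (by simpa using h)

theorem exists_tri {S : Finset Pt} (D : PlaneGraph S) :
    ∃ T : PlaneGraph S, IsTriangulation T ∧ D.edges ⊆ T.edges := by
  have := finPG S
  obtain ⟨T, hT, hmax⟩ := Set.exists_max_image {G : PlaneGraph S | D.edges ⊆ G.edges}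
    (fun G => G.edges.card) (Set.toFinite _) ⟨D, Finset.Subset.refl _⟩
  refine ⟨T, ?_, hT⟩
  intro G hG
  exact (Finset.eq_of_subset_of_card_le hG (hmax G (Finset.Subset.trans hT hG))).symm

theorem supp_pos {S : Finset Pt} (D : PlaneGraph S) : 1 ≤ supp D := by
  have := finPG S
  obtain ⟨T, hT⟩ := exists_tri D
  have : Nonempty {T : PlaneGraph S // IsTriangulation T ∧ D.edges ⊆ T.edges} := ⟨⟨T, hT⟩⟩
  exact Nat.card_pos

theorem supp_anti {S : Finset Pt} {D D' : PlaneGraph S} (h : D.edges ⊆ D'.edges) : supp D' ≤ supp D := by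
  have := finPG S
  apply Nat.card_le_card_of_injective (fun T => ⟨T.1, T.2.1, Finset.Subset.trans h T.2.2⟩)
  intro T T' h
  exact Subtype.ext (by simpa using h)

theorem supp_add {S : Finset Pt} {D D1 D2 : PlaneGraph S} (h1 : D.edges ⊆ D1.edges)
    (h2 : D.edges ⊆ D2.edges)
    (h : ∀ G : PlaneGraph S, D1.edges ⊆ G.edges → D2.edges ⊆ G.edges → False) :
    supp D1 + supp D2 ≤ supp D := by
  have := finPG S
  unfold supp
  rw [← Nat.card_sum]
  apply Nat.card_le_card_of_injective (Sum.elim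
    (fun T => ⟨T.1, T.2.1, Finset.Subset.trans h1 T.2.2⟩)
    (fun T => ⟨T.1, T.2.1, Finset.Subset.trans h2 T.2.2⟩))
  rintro (T | T) (T' | T') e
  · simp only [Sum.elim_inl, Subtype.mk.injEq] at e
    rw [Subtype.ext e]
  · simp only [Sum.elim_inl, Sum.elim_inr, Subtype.mk.injEq] at e
    exact (h T.1 T.2.2 (e ▸ T'.2.2)).elim
  · simp only [Sum.elim_inl, Sum.elim_inr, Subtype.mk.injEq] at e
    exact (h T'.1 T'.2.2 (e ▸ T.2.2)).elim
  · simp only [Sum.elim_inr, Subtype.mk.injEq] at e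
    rw [Subtype.ext e]

theorem supp_ind {S : Finset Pt} (hS : GenPos S) (E0 : ℕ)
    (hE : ∀ T : PlaneGraph S, IsTriangulation T → E0 ≤ T.edges.card) (k : ℕ) :
    ∀ D : PlaneGraph S, WedgeGood D → D.edges.card + k ≤ E0 → 2 ^ k ≤ supp D := by
  induction k with
  | zero => intro D _ _; simpa using supp_pos D
  | succ k ih =>
    intro D hD hk
    obtain ⟨T, hT, hDT⟩ := exists_tri D
    have hcard := hE T hT
    have : ∃ e ∈ T.edges, e ∉ D.edges := by
      by_contra hcon
      push Not at hcon
      have := Finset.card_le_card (s := T.edges) (t := D.edges) hcon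
      omega
    obtain ⟨e, he, heD⟩ := this
    induction e using Sym2.ind with
    | _ p q =>
      obtain ⟨D1, D2, h1, h2, c1, c2, hno⟩ := flip_pair hS T hT D hD hDT he heD
      have i1 := ih D1 (hD.mono h1) (by omega)
      have i2 := ih D2 (hD.mono h2) (by omega)
      have := supp_add h1 h2 hno
      rw [pow_succ]
      omega


/-- hull vertices, witnessed by the counterclockwise successor -/
def Succ (S : Finset Pt) (p s : Pt) : Prop :=
  s ∈ S ∧ s ≠ p ∧ ∀ d ∈ S, d ≠ p → d ≠ s → 0 < ori p s d

def Hul (S : Finset Pt) (p : Pt) : Prop := ∃ s, Succ S p s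

theorem succ_unique {S : Finset Pt} {p s s' : Pt} (h : Succ S p s) (h' : Succ S p s') : s = s' := by
  by_contra hne
  have h1 := h.2.2 s' h'.1 h'.2.1 (Ne.symm hne)
  have h2 := h'.2.2 s h.1 h.2.1 hne
  rw [ori_swap2] at h2
  linarith

theorem not_hul {S : Finset Pt} (hS : GenPos S) {p q : Pt} (hp : p ∈ S) (hq : q ∈ S) (hqp : q ≠ p)
    (h : ¬ Hul S p) : ∃ d ∈ S, ori p q d < 0 := by
  by_contra hcon
  push Not at hcon
  apply h
  refine ⟨q, hq, hqp, fun d hd hdp hdq => ?_⟩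
  exact lt_of_le_of_ne (hcon d hd) (genpos_ori hS hp hq hd hqp.symm hdp.symm hdq.symm).symm

theorem interior_edges {S : Finset Pt} (hS : GenPos S) (T : PlaneGraph S) (hT : IsTriangulation T)
    {p u : Pt} (hpu : s(p, u) ∈ T.edges) (h : ¬ Hul S p) :
    ∃ b c, s(p, b) ∈ T.edges ∧ s(p, c) ∈ T.edges ∧ 0 < ori p u c ∧ 0 < ori p c b ∧ 0 < ori p b u := by
  have hp := edge_mem_left T hpu
  have hu := edge_mem_right T hpu
  have hne := edge_ne T hpu
  obtain ⟨d, hd, hdo⟩ := not_hul hS hp hu hne.symm h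
  obtain ⟨x, hx⟩ := exists_face hS T hT (edge_symm T hpu) ⟨d, hd, by rw [ori_swap]; linarith⟩
  have hxo := hx.1
  rw [ori_swap] at hxo
  have hxe := hx.2.2.1
  obtain ⟨b, hb, hmin⟩ := ang_min (u.2 - p.2) (-(u.1 - p.1)) p
    (S.filter (fun d => s(p, d) ∈ T.edges ∧ ori p u d < 0))
    ⟨x, by rw [Finset.mem_filter]; exact ⟨edge_mem_right T hxe, hxe, by linarith⟩⟩
    (by
      intro c hc
      have := (Finset.mem_filter.1 hc).2.2
      unfold ori at this
      linarith)
  obtain ⟨hbS, hbT, hbo⟩ := Finset.mem_filter.1 hb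
  obtain ⟨d', hd', hdo'⟩ := not_hul hS hp hbS (edge_ne T hbT).symm h
  obtain ⟨c, hc⟩ := exists_face hS T hT (edge_symm T hbT) ⟨d', hd', by rw [ori_swap]; linarith⟩
  have hco := hc.1
  rw [ori_swap] at hco
  have hce := hc.2.2.1
  have hbu : 0 < ori p b u := by rw [ori_swap2]; linarith
  have hcu : c ≠ u := by rintro rfl; linarith
  have hcp := edge_ne T hce
  have huc : 0 ≤ ori p u c := by
    by_contra hcon
    have := hmin c (by rw [Finset.mem_filter]; exact ⟨edge_mem_right T hce, hce, by linarith⟩)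
    linarith
  have hn := genpos_ori hS hp hu (edge_mem_right T hce) hne hcp hcu.symm
  exact ⟨b, c, hbT, hce, lt_of_le_of_ne huc hn.symm, by rw [ori_swap2]; linarith, hbu⟩

theorem wedge3 {S : Finset Pt} (hS : GenPos S) (D : PlaneGraph S) {p u b c q : Pt}
    (hu : s(p, u) ∈ D.edges) (hb : s(p, b) ∈ D.edges) (hc : s(p, c) ∈ D.edges)
    (h1 : 0 < ori p u c) (h2 : 0 < ori p c b) (h3 : 0 < ori p b u) (hq : q ∈ S) (hpq : p ≠ q) :
    s(p, q) ∈ D.edges ∨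
    ∃ a b, s(p, a) ∈ D.edges ∧ s(p, b) ∈ D.edges ∧ 0 < ori p a q ∧ 0 < ori p q b ∧ 0 < ori p a b := by
  by_cases hD : s(p, q) ∈ D.edges
  · exact Or.inl hD
  right
  have nz : ∀ x, s(p, x) ∈ D.edges → ori p x q ≠ 0 := by
    intro x hx
    refine genpos_ori hS (edge_mem_left D hx) (edge_mem_right D hx) hq (edge_ne D hx) hpq ?_
    rintro rfl
    exact hD hx
  have nu := nz u hu
  have nb := nz b hb
  have nc := nz c hc
  have id : ori p c b * ori p u q + ori p b u * ori p c q + ori p u c * ori p b q = 0 := by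
    unfold ori; ring
  rcases nu.lt_or_gt with ku | ku <;> rcases nb.lt_or_gt with kb | kb <;>
    rcases nc.lt_or_gt with kc | kc
  · exfalso; nlinarith [mul_pos h2 (neg_pos.2 ku), mul_pos h3 (neg_pos.2 kc), mul_pos h1 (neg_pos.2 kb)]
  · exact ⟨c, b, hc, hb, kc, by rw [ori_swap2]; linarith, h2⟩
  · exact ⟨b, u, hb, hu, kb, by rw [ori_swap2]; linarith, h3⟩
  · exact ⟨b, u, hb, hu, kb, by rw [ori_swap2]; linarith, h3⟩
  · exact ⟨u, c, hu, hc, ku, by rw [ori_swap2]; linarith, h1⟩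
  · exact ⟨c, b, hc, hb, kc, by rw [ori_swap2]; linarith, h2⟩
  · exact ⟨u, c, hu, hc, ku, by rw [ori_swap2]; linarith, h1⟩
  · exfalso; nlinarith [mul_pos h2 ku, mul_pos h3 kc, mul_pos h1 kb]

theorem hull_edge {S : Finset Pt} (hS : GenPos S) (T : PlaneGraph S) (hT : IsTriangulation T)
    {p s : Pt} (hp : p ∈ S) (h : Succ S p s) : s(p, s) ∈ T.edges := by
  apply max_edge hS T hT hp h.1 h.2.1.symm
  intro u v huv hne y hy hyu
  have k1 := cross_off hS hp h.1 (edge_mem_left T huv) (edge_mem_right T huv) h.2.1.symm hne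
    (edge_ne T huv) hy hyu
  have k2 := cross_off' hS hp h.1 (edge_mem_left T huv) (edge_mem_right T huv) h.2.1.symm hne
    (edge_ne T huv) hy hyu
  have pos : ∀ x ∈ S, ori p s x ≠ 0 → 0 < ori p s x := by
    intro x hx hx0
    apply h.2.2 x hx
    · rintro rfl; exact hx0 (ori_aba _ _)
    · rintro rfl; exact hx0 (ori_abb _ _)
  have p1 := pos u (edge_mem_left T huv) k1
  have p2 := pos v (edge_mem_right T huv) k2
  have z := seg_ori _ _ _ (oseg_sub _ _ _ hy)
  obtain ⟨t, ht0, ht1, e1, e2⟩ := (mem_seg _ _ _).1 hyu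
  rw [ori_comb p s u v y t e1 e2] at z
  rcases ht0.lt_or_eq with h | h
  · nlinarith [mul_pos h p2, mul_nonneg (sub_nonneg.2 ht1) p1.le]
  · rw [← h] at z; linarith

theorem exists_pred {S : Finset Pt} (hS : GenPos S) (h3 : 3 ≤ S.card)
    {p s : Pt} (hp : p ∈ S) (h : Succ S p s) : ∃ a ∈ S, a ≠ s ∧ Succ S a p := by
  have hne : ((S.erase p).erase s).Nonempty := by
    rw [← Finset.card_pos, Finset.card_erase_of_mem (Finset.mem_erase.2 ⟨h.2.1, h.1⟩),
      Finset.card_erase_of_mem hp]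
    omega
  obtain ⟨a, ha, hm⟩ := ang_max (-(s.2 - p.2)) (s.1 - p.1) p ((S.erase p).erase s) hne (by
    intro c hc
    simp only [Finset.mem_erase] at hc
    exact (ori_as_lin p s c).1 (h.2.2 c hc.2.2 hc.2.1 hc.1))
  simp only [Finset.mem_erase] at ha
  refine ⟨a, ha.2.2, ha.1, hp, ha.2.1.symm, ?_⟩
  intro d hd hda hdp
  by_cases hds : d = s
  · subst hds
    rw [← ori_cyc a p d]
    exact h.2.2 a ha.2.2 ha.2.1 ha.1
  · have := hm d (by simp only [Finset.mem_erase]; exact ⟨hds, hdp, hd⟩)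
    rw [ori_swap]
    have := genpos_ori hS hp ha.2.2 hd ha.2.1.symm hdp.symm hda.symm
    have : ori p a d < 0 := lt_of_le_of_ne (by assumption) this
    linarith

theorem notH_A {S : Finset Pt} (hS : GenPos S) (t : ℝ)
    (hi : ∀ p ∈ S, ∀ q ∈ S, fn t p = fn t q → p = q) {p : Pt} (hp : p ∈ S) (h : ¬ Hul S p)
    (hl : ∃ l ∈ S, fn t l < fn t p) : InA S t p := by
  obtain ⟨l0, hl0, hlt⟩ := hl
  obtain ⟨l, hl, hm⟩ := ang_min (-1) (-t) p (S.filter (fun d => fn t d < fn t p))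
    ⟨l0, Finset.mem_filter.2 ⟨hl0, hlt⟩⟩ (by
      intro c hc
      have := (Finset.mem_filter.1 hc).2
      unfold fn at this
      linarith)
  obtain ⟨hlS, hlf⟩ := Finset.mem_filter.1 hl
  have hlp : l ≠ p := by rintro rfl; exact lt_irrefl _ hlf
  obtain ⟨d, hd, hdo⟩ := not_hul hS hp hlS hlp h
  refine ⟨l, hlS, d, hd, hlf, ?_, by rw [ori_swap]; linarith⟩
  by_contra hcon
  push Not at hcon
  rcases hcon.lt_or_eq with e | e
  · have := hm d (Finset.mem_filter.2 ⟨hd, e⟩)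
    linarith
  · have := hi d hd p hp e
    subst this
    rw [ori_aba] at hdo
    exact lt_irrefl _ hdo

theorem notH_B {S : Finset Pt} (hS : GenPos S) (t : ℝ)
    (hi : ∀ p ∈ S, ∀ q ∈ S, fn t p = fn t q → p = q) {p : Pt} (hp : p ∈ S) (h : ¬ Hul S p)
    (hr : ∃ l ∈ S, fn t p < fn t l) : InB S t p := by
  obtain ⟨l0, hl0, hlt⟩ := hr
  obtain ⟨l, hl, hm⟩ := ang_min 1 t p (S.filter (fun d => fn t p < fn t d))
    ⟨l0, Finset.mem_filter.2 ⟨hl0, hlt⟩⟩ (fun c hc => (Finset.mem_filter.1 hc).2)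
  obtain ⟨hlS, hlf⟩ := Finset.mem_filter.1 hl
  have hlp : l ≠ p := by rintro rfl; exact lt_irrefl _ hlf
  obtain ⟨d, hd, hdo⟩ := not_hul hS hp hlS hlp h
  refine ⟨d, hd, l, hlS, ?_, hlf, by rw [← ori_cyc d p l]; linarith⟩
  by_contra hcon
  push Not at hcon
  rcases hcon.lt_or_eq with e | e
  · have := hm d (Finset.mem_filter.2 ⟨hd, e⟩)
    linarith
  · have := hi p hp d hd e
    subst this
    rw [ori_aba] at hdo
    exact lt_irrefl _ hdo

theorem notH_AB {S : Finset Pt} (hS : GenPos S) (h3 : 3 ≤ S.card) (t : ℝ)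
    (hi : ∀ p ∈ S, ∀ q ∈ S, fn t p = fn t q → p = q) {p : Pt} (hp : p ∈ S) (h : ¬ Hul S p) :
    InA S t p ∧ InB S t p := by
  have hA := notH_A hS t hi hp h
  have hB := notH_B hS t hi hp h
  obtain ⟨q, hq, hqp⟩ := Finset.exists_mem_ne (s := S) (by omega) p
  rcases lt_trichotomy (fn t q) (fn t p) with e | e | e
  · obtain ⟨l, hl, r, hr, h1, h2, h3⟩ := hA ⟨q, hq, e⟩
    exact ⟨hA ⟨q, hq, e⟩, hB ⟨r, hr, h2⟩⟩
  · exact absurd (hi q hq p hp e) hqp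
  · obtain ⟨l, hl, r, hr, h1, h2, h3⟩ := hB ⟨q, hq, e⟩
    exact ⟨hA ⟨l, hl, h1⟩, hB ⟨q, hq, e⟩⟩

theorem cost {S : Finset Pt} (hS : GenPos S) (h3 : 3 ≤ S.card) (t : ℝ)
    (hi : ∀ p ∈ S, ∀ q ∈ S, fn t p = fn t q → p = q) :
    S.card + (S.filter (fun p => ¬ Hul S p)).card ≤
      (S.filter (InA S t)).card + (S.filter (InB S t)).card + 2 := by
  have hne : S.Nonempty := Finset.card_pos.1 (by omega)
  obtain ⟨m, hm, hmax⟩ := S.exists_max_image (fn t) hne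
  obtain ⟨l, hl, hmin⟩ := S.exists_min_image (fn t) hne
  have s1 : S.filter (fun p => ¬ Hul S p) ⊆ S.filter (InA S t) ∩ S.filter (InB S t) := by
    intro p hp
    obtain ⟨hpS, hpH⟩ := Finset.mem_filter.1 hp
    obtain ⟨k1, k2⟩ := notH_AB hS h3 t hi hpS hpH
    exact Finset.mem_inter.2 ⟨Finset.mem_filter.2 ⟨hpS, k1⟩, Finset.mem_filter.2 ⟨hpS, k2⟩⟩
  have s2 : S ⊆ (S.filter (InA S t) ∪ S.filter (InB S t)) ∪ {m, l} := by
    intro p hp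
    by_cases hpm : p = m
    · simp [hpm]
    by_cases hpl : p = l
    · simp [hpl]
    have f1 : fn t p < fn t m := lt_of_le_of_ne (hmax p hp) (fun h => hpm (hi p hp m hm h))
    have f2 : fn t l < fn t p := lt_of_le_of_ne (hmin p hp) (fun h => hpl (hi l hl p hp h).symm)
    have hlm : l ≠ m := by rintro rfl; linarith
    have := genpos_ori hS hl hp hm (Ne.symm hpl) hlm hpm
    apply Finset.mem_union_left
    rcases this.lt_or_gt with k | k
    · exact Finset.mem_union_right _ (Finset.mem_filter.2 ⟨hp, l, hl, m, hm, f2, f1, k⟩)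
    · exact Finset.mem_union_left _ (Finset.mem_filter.2 ⟨hp, l, hl, m, hm, f2, f1, k⟩)
  have c1 := Finset.card_le_card s1
  have c2 := Finset.card_le_card s2
  have c3 := Finset.card_union_le (S.filter (InA S t) ∪ S.filter (InB S t)) {m, l}
  have c4 : ({m, l} : Finset Pt).card ≤ 2 := Finset.card_le_two
  have c5 := Finset.card_union_add_card_inter (S.filter (InA S t)) (S.filter (InB S t))
  omega

theorem matching_card {S : Finset Pt} (M : PlaneGraph S) (hM : IsPerfectMatching M) :
    M.edges.card * 2 ≤ S.card := by
  have h1 : ∑ p ∈ S, (M.edges.filter (fun e => p ∈ e)).card = S.card := by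
    rw [Finset.card_eq_sum_ones]
    apply Finset.sum_congr rfl
    intro p hp
    obtain ⟨e, ⟨he, hpe⟩, hu⟩ := hM p hp
    rw [Finset.card_eq_one]
    refine ⟨e, ?_⟩
    ext e'
    rw [Finset.mem_filter, Finset.mem_singleton]
    constructor
    · exact fun h => hu e' h
    · rintro rfl; exact ⟨he, hpe⟩
  have h2 : M.edges.card * 2 ≤ ∑ e ∈ M.edges, (S.filter (fun p => p ∈ e)).card := by
    rw [← smul_eq_mul]
    apply Finset.card_nsmul_le_sum
    intro e he
    induction e using Sym2.ind with
    | _ a b =>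
      rw [← Finset.card_pair (edge_ne M he)]
      apply Finset.card_le_card
      intro x hx
      rw [Finset.mem_insert, Finset.mem_singleton] at hx
      rw [Finset.mem_filter, Sym2.mem_iff]
      refine ⟨?_, hx⟩
      rcases hx with rfl | rfl
      · exact edge_mem_left M he
      · exact edge_mem_right M he
  have h5 : ∑ p ∈ S, (M.edges.filter (fun e => p ∈ e)).card =
      ∑ e ∈ M.edges, (S.filter (fun p => p ∈ e)).card := by
    simp only [Finset.card_filter]
    exact Finset.sum_comm
  omega

theorem exists_D {S : Finset Pt} (hS : GenPos S) (h3 : 3 ≤ S.card)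
    (T : PlaneGraph S) (hT : IsTriangulation T)
    (M : PlaneGraph S) (hM : IsPerfectMatching M) (hMT : M.edges ⊆ T.edges) :
    ∃ D : PlaneGraph S, M.edges ⊆ D.edges ∧ WedgeGood D ∧
      D.edges.card ≤ M.edges.card + S.card + (S.filter (fun p => ¬ Hul S p)).card := by
  have hm : ∀ p, p ∈ S → ∃ u, s(p, u) ∈ M.edges := by
    intro p hp
    obtain ⟨e, ⟨he, ⟨u, rfl⟩⟩, -⟩ := hM p hp
    exact ⟨u, he⟩
  choose! u hu using hm
  have hi : ∀ p, p ∈ S → ¬ Hul S p → ∃ b c, s(p, b) ∈ T.edges ∧ s(p, c) ∈ T.edges ∧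
      0 < ori p (u p) c ∧ 0 < ori p c b ∧ 0 < ori p b (u p) :=
    fun p hp h => interior_edges hS T hT (hMT (hu p hp)) h
  choose! b c hb hc h1 h2 h4 using hi
  have hh : ∀ p, Hul S p → ∃ s, Succ S p s := fun p h => h
  choose! sc hsc using hh
  set E : Finset (Sym2 Pt) := ((M.edges ∪ (S.filter (Hul S)).image (fun p => s(p, sc p))) ∪
    (S.filter (fun p => ¬ Hul S p)).image (fun p => s(p, b p))) ∪
    (S.filter (fun p => ¬ Hul S p)).image (fun p => s(p, c p)) with hE
  have hET : E ⊆ T.edges := by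
    intro e he
    simp only [hE, Finset.mem_union, Finset.mem_image, Finset.mem_filter] at he
    rcases he with ((he | ⟨p, ⟨hp, hpH⟩, rfl⟩) | ⟨p, ⟨hp, hpH⟩, rfl⟩) | ⟨p, ⟨hp, hpH⟩, rfl⟩
    · exact hMT he
    · exact hull_edge hS T hT hp (hsc p hpH)
    · exact hb p hp hpH
    · exact hc p hp hpH
  have m1 : M.edges ⊆ E := by
    intro e he
    simp only [hE, Finset.mem_union]; tauto
  have m2 : ∀ p ∈ S, Hul S p → s(p, sc p) ∈ E := by
    intro p hp hpH
    rw [hE]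
    exact Finset.mem_union_left _ (Finset.mem_union_left _ (Finset.mem_union_right _
      (Finset.mem_image_of_mem (fun p => s(p, sc p)) (Finset.mem_filter.2 ⟨hp, hpH⟩))))
  have m3 : ∀ p ∈ S, ¬ Hul S p → s(p, b p) ∈ E := by
    intro p hp hpH
    rw [hE]
    exact Finset.mem_union_left _ (Finset.mem_union_right _
      (Finset.mem_image_of_mem (fun p => s(p, b p)) (Finset.mem_filter.2 ⟨hp, hpH⟩)))
  have m4 : ∀ p ∈ S, ¬ Hul S p → s(p, c p) ∈ E := by
    intro p hp hpH
    rw [hE]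
    exact Finset.mem_union_right _
      (Finset.mem_image_of_mem (fun p => s(p, c p)) (Finset.mem_filter.2 ⟨hp, hpH⟩))
  refine ⟨subG T E hET, m1, ?_, ?_⟩
  · intro p hp q hq hpq
    by_cases hpH : Hul S p
    · have hs := hsc p hpH
      obtain ⟨a, ha, has, hpr⟩ := exists_pred hS h3 hp hs
      have hap : sc a = p := succ_unique (hsc a ⟨p, hpr⟩) hpr
      have e1 := m2 p hp hpH
      have e2 := m2 a ha ⟨p, hpr⟩
      rw [hap, Sym2.eq_swap] at e2
      by_cases hqs : q = sc p
      · left; rw [hqs]; exact e1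
      by_cases hqa : q = a
      · left; rw [hqa]; exact e2
      right
      refine ⟨sc p, a, e1, e2, hs.2.2 q hq hpq.symm hqs, ?_, hs.2.2 a ha hpr.2.1.symm has⟩
      have := hpr.2.2 q hq hqa hpq.symm
      rwa [ori_cyc a p q]
    · exact wedge3 hS (subG T E hET) (m1 (hu p hp)) (m3 p hp hpH) (m4 p hp hpH)
        (h1 p hp hpH) (h2 p hp hpH) (h4 p hp hpH) hq hpq
  · change E.card ≤ _
    rw [hE]
    have k1 := Finset.card_union_le ((M.edges ∪ (S.filter (Hul S)).image (fun p => s(p, sc p))) ∪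
      (S.filter (fun p => ¬ Hul S p)).image (fun p => s(p, b p)))
      ((S.filter (fun p => ¬ Hul S p)).image (fun p => s(p, c p)))
    have k2 := Finset.card_union_le (M.edges ∪ (S.filter (Hul S)).image (fun p => s(p, sc p)))
      ((S.filter (fun p => ¬ Hul S p)).image (fun p => s(p, b p)))
    have k3 := Finset.card_union_le M.edges ((S.filter (Hul S)).image (fun p => s(p, sc p)))
    have k4 := Finset.card_image_le (s := S.filter (Hul S)) (f := fun p => s(p, sc p))
    have k5 := Finset.card_image_le (s := S.filter (fun p => ¬ Hul S p)) (f := fun p => s(p, b p))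
    have k6 := Finset.card_image_le (s := S.filter (fun p => ¬ Hul S p)) (f := fun p => s(p, c p))
    have k7 := Finset.card_filter_add_card_filter_not (s := S) (Hul S)
    omega

/-- any perfect matching contained in a triangulation of an
even-size point set has support at least `2^{N/2 - 3}`. -/
theorem statement18 (S : Finset Pt) (hS : GenPos S) (heven : Even S.card)
    (T : PlaneGraph S) (hT : IsTriangulation T)
    (M : PlaneGraph S) (hM : IsPerfectMatching M) (hMT : M.edges ⊆ T.edges) :
    (2 : ℝ) ^ ((S.card : ℝ) / 2 - 3) ≤ (supp M : ℝ) := by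
  by_cases h6 : S.card ≤ 6
  · have h1 : (2 : ℝ) ^ ((S.card : ℝ) / 2 - 3) ≤ (2 : ℝ) ^ (0 : ℝ) := by
      apply Real.rpow_le_rpow_of_exponent_le (by norm_num)
      have : (S.card : ℝ) ≤ 6 := by exact_mod_cast h6
      linarith
    rw [Real.rpow_zero] at h1
    refine h1.trans ?_
    exact_mod_cast supp_pos M
  · push Not at h6
    obtain ⟨m, hm⟩ := heven
    obtain ⟨t, hi⟩ := exists_generic S
    obtain ⟨D, hMD, hD, hcard⟩ := exists_D hS (by omega) T hT M hM hMT
    have hcost := cost hS (by omega) t hi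
    have hmc := matching_card M hM
    have hne : S.Nonempty := Finset.card_pos.1 (by omega)
    have key := supp_ind hS
      (S.card + (S.filter (InA S t)).card + (S.filter (InB S t)).card - 1)
      (fun T hT => by have := edge_count hS T hT t hi hne; omega) (m - 3) D hD (by omega)
    have h2 := key.trans (supp_anti hMD)
    have e : (S.card : ℝ) / 2 - 3 = ((m - 3 : ℕ) : ℝ) := by
      rw [Nat.cast_sub (by omega), hm]
      push_cast
      ring
    rw [e, Real.rpow_natCast]
    exact_mod_cast h2

end
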